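/- arXiv:2601.23104 — 8 statements merged into one kernel-verified Lean document; each statement's English description precedes it below -/
import Mathlib

section
/- For every k ≥ 1, the broadcast time of the k-dimensional binomial tree is b(BT_k) = 2k − 1. -/
/-- A broadcast scheme from originator `v`: `A i` is the set of informed vertices
after `i` time units.  At time 0 only `v` is informed, and during each time unit every
informed vertex may inform at most one uninformed neighbor. -/
def IsBroadcastScheme {V : Type*} [DecidableEq V] (G : SimpleGraph V) (v : V)
    (A : ℕ → Finset V) : Prop :=
  A 0 = {v} ∧
  ∀ i : ℕ, A i ⊆ A (i + 1) ∧
    ∃ f : V → V,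
      (∀ w ∈ A (i + 1) \ A i, f w ∈ A i ∧ G.Adj (f w) w) ∧
      Set.InjOn f ↑(A (i + 1) \ A i)

/-- `b(v, G)`: the minimum number of time units needed to inform all vertices from `v`. -/
noncomputable def broadcastTimeFrom {V : Type*} [DecidableEq V] [Fintype V]
    (G : SimpleGraph V) (v : V) : ℕ :=
  sInf {T | ∃ A : ℕ → Finset V, IsBroadcastScheme G v A ∧ A T = Finset.univ}

/-- `b(G)`: the maximum over all originators `v` of `b(v, G)`. -/
noncomputable def broadcastTime {V : Type*} [DecidableEq V] [Fintype V]
    (G : SimpleGraph V) : ℕ :=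
  Finset.univ.sup fun v => broadcastTimeFrom G v

/-- The parent of `j ≠ 0` in the binomial tree encoding: clear the highest set bit. -/
def btParent (j : ℕ) : ℕ := j - 2 ^ Nat.log 2 j

/-- The `k`-dimensional binomial tree `BT k` on `2^k` vertices, rooted at `0`:
vertex `j ≠ 0` is joined to its parent, obtained by clearing the highest set bit of `j`.
The root's children `2^(k-1), …, 2, 1` root disjoint copies of
`BT 0, …, BT (k-2), BT (k-1)` respectively. -/
def BT (k : ℕ) : SimpleGraph (Fin (2 ^ k)) :=
  SimpleGraph.fromRel fun i j => (j : ℕ) ≠ 0 ∧ (i : ℕ) = btParent (j : ℕ)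

theorem btParent_lt {j : ℕ} (hj : j ≠ 0) : btParent j < j := by
  have : 0 < 2 ^ Nat.log 2 j := by positivity
  unfold btParent
  omega

theorem btParent_eq_sub {s j : ℕ} (h₁ : 2 ^ s ≤ j) (h₂ : j < 2 ^ (s + 1)) :
    btParent j = j - 2 ^ s := by
  have : Nat.log 2 j = s := Nat.log_eq_of_pow_le_of_lt_pow h₁ h₂
  rw [btParent, this]

theorem BT_adj_of_eq_btParent {k : ℕ} {x y : Fin (2 ^ k)} (hy : (y : ℕ) ≠ 0)
    (hxy : (x : ℕ) = btParent y) : (BT k).Adj x y := by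
  rw [BT, SimpleGraph.fromRel_adj]
  refine ⟨?_, Or.inl ⟨hy, hxy⟩⟩
  rintro rfl
  exact absurd hxy (btParent_lt hy).ne'

/-- Walk towards the root, then alternate between the root `0` and its child `1`. -/
def rootward (j : ℕ) : ℕ := if j = 0 then 1 else btParent j

theorem rootward_lt {k j : ℕ} (hk : 1 ≤ k) (hj : j < 2 ^ k) : rootward j < 2 ^ k := by
  unfold rootward
  split_ifs with h
  · exact Nat.one_lt_two_pow (by omega)
  · exact (btParent_lt h).trans hj

theorem exists_iterate_rootward_eq {k : ℕ} (hk : 1 ≤ k) {r : ℕ} (hr : r < 2) :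
    ∀ {j : ℕ}, j < 2 ^ k → ∃ i ≤ k, rootward^[i] j = r := by
  induction k, hk using Nat.le_induction with
  | base =>
    intro j hj
    by_cases h : j = r
    · exact ⟨0, by omega, h⟩
    · refine ⟨1, le_rfl, ?_⟩
      have h01 : j = 0 ∧ r = 1 ∨ j = 1 ∧ r = 0 := by omega
      rcases h01 with ⟨rfl, rfl⟩ | ⟨rfl, rfl⟩ <;> simp [rootward, btParent]
  | succ k hk ih =>
    intro j hj
    by_cases h : j < 2 ^ k
    · obtain ⟨i, hi, hij⟩ := ih h
      exact ⟨i, by omega, hij⟩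
    · have hp : rootward j = j - 2 ^ k := by
        have : 0 < 2 ^ k := by positivity
        rw [rootward, if_neg (by omega), btParent_eq_sub (by omega) hj]
      obtain ⟨i, hi, hij⟩ := ih (j := rootward j) (by rw [hp]; rw [pow_succ] at hj; omega)
      exact ⟨i + 1, by omega, hij⟩

theorem BT_adj_rootward {k : ℕ} {x y : Fin (2 ^ k)} (h : (y : ℕ) = rootward x) :
    (BT k).Adj x y := by
  unfold rootward at h
  split_ifs at h with hx
  · exact BT_adj_of_eq_btParent (by omega) (by rw [hx, h]; simp [btParent])
  · exact (BT_adj_of_eq_btParent hx h).symm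

/-- Inform the first `k` vertices of the rootward walk from `v`, one per time unit, and
afterwards let each informed `j < 2 ^ s` inform `j + 2 ^ s`. -/
def btScheme (k v t : ℕ) : Finset (Fin (2 ^ k)) :=
  Finset.univ.filter fun j =>
    (∃ i ≤ t, i ≤ k ∧ rootward^[i] v = j) ∨ (k ≤ t ∧ (j : ℕ) < 2 ^ (t - k + 1))

theorem mem_btScheme {k v t : ℕ} {j : Fin (2 ^ k)} : j ∈ btScheme k v t ↔
    (∃ i ≤ t, i ≤ k ∧ rootward^[i] v = j) ∨ (k ≤ t ∧ (j : ℕ) < 2 ^ (t - k + 1)) := by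
  simp [btScheme]

theorem isBroadcastScheme_btScheme {k : ℕ} (hk : 1 ≤ k) (v : Fin (2 ^ k)) :
    IsBroadcastScheme (BT k) v (btScheme k v) := by
  constructor
  · ext j
    rw [mem_btScheme, Finset.mem_singleton, Fin.ext_iff]
    constructor
    · rintro (⟨i, hi, -, h⟩ | ⟨h, -⟩)
      · obtain rfl : i = 0 := by omega
        exact h.symm
      · omega
    · exact fun h => Or.inl ⟨0, le_rfl, by omega, h.symm⟩
  intro t
  refine ⟨fun j hj => ?_, ?_⟩
  · rw [mem_btScheme] at hj ⊢
    rcases hj with ⟨i, hi, hik, h⟩ | ⟨h, hj⟩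
    · exact Or.inl ⟨i, by omega, hik, h⟩
    · exact Or.inr ⟨by omega, hj.trans_le (Nat.pow_le_pow_right (by omega) (by omega))⟩
  have hlt (i : ℕ) : rootward^[i] v < 2 ^ k := by
    induction i with
    | zero => exact v.isLt
    | succ i ih =>
      rw [Function.iterate_succ_apply']
      exact rootward_lt hk ih
  rcases lt_or_ge t k with htk | hkt
  · have hnew (w) (hw : w ∈ btScheme k v (t + 1) \ btScheme k v t) :
        (w : ℕ) = rootward^[t + 1] v := by
      rw [Finset.mem_sdiff, mem_btScheme, mem_btScheme, not_or] at hw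
      obtain ⟨⟨i, hi, hik, h⟩ | ⟨h, hj⟩, hw, -⟩ := hw
      · by_cases hit : i ≤ t
        · exact absurd ⟨i, hit, hik, h⟩ hw
        · obtain rfl : i = t + 1 := by omega
          exact h.symm
      · obtain ⟨i, hi, h'⟩ := exists_iterate_rootward_eq hk
          (by simpa [show t + 1 - k = 0 by omega] using hj) v.isLt
        by_cases hit : i ≤ t
        · exact absurd ⟨i, hit, hi, h'⟩ hw
        · obtain rfl : i = t + 1 := by omega
          exact h'.symm
    refine ⟨fun _ => ⟨rootward^[t] v, hlt t⟩, fun w hw => ⟨?_, ?_⟩, ?_⟩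
    · exact mem_btScheme.2 (Or.inl ⟨t, le_rfl, htk.le, rfl⟩)
    · apply BT_adj_rootward
      rw [hnew w hw, Function.iterate_succ_apply']
    · intro x hx y hy _
      exact Fin.ext ((hnew x hx).trans (hnew y hy).symm)
  · have hnew (w) (hw : w ∈ btScheme k v (t + 1) \ btScheme k v t) :
        2 ^ (t - k + 1) ≤ (w : ℕ) ∧ (w : ℕ) < 2 ^ (t - k + 1 + 1) := by
      rw [Finset.mem_sdiff, mem_btScheme, mem_btScheme, not_or] at hw
      obtain ⟨⟨i, hi, hik, h⟩ | ⟨h, hj⟩, hw, hw'⟩ := hw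
      · exact absurd ⟨i, by omega, hik, h⟩ hw
      · refine ⟨by_contra fun hc => hw' ⟨hkt, by omega⟩, ?_⟩
        rwa [show t + 1 - k = t - k + 1 by omega] at hj
    refine ⟨fun w => ⟨w - 2 ^ (t - k + 1), (Nat.sub_le _ _).trans_lt w.isLt⟩,
      fun w hw => ⟨?_, ?_⟩, ?_⟩
    · obtain ⟨h₁, h₂⟩ := hnew w hw
      rw [pow_succ 2 (t - k + 1)] at h₂
      exact mem_btScheme.2 (Or.inr ⟨hkt, show (w : ℕ) - 2 ^ (t - k + 1) < _ by omega⟩)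
    · obtain ⟨h₁, h₂⟩ := hnew w hw
      have : 0 < 2 ^ (t - k + 1) := by positivity
      exact BT_adj_of_eq_btParent (by omega) (btParent_eq_sub h₁ h₂).symm
    · intro x hx y hy h
      have hx' := (hnew x hx).1
      have hy' := (hnew y hy).1
      have h' : (x : ℕ) - 2 ^ (t - k + 1) = y - 2 ^ (t - k + 1) := congrArg Fin.val h
      exact Fin.ext (by omega)

theorem btScheme_eq_univ {k : ℕ} (hk : 1 ≤ k) (v : ℕ) :
    btScheme k v (2 * k - 1) = Finset.univ := by
  refine Finset.eq_univ_of_forall fun j => mem_btScheme.2 (Or.inr ⟨by omega, ?_⟩)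
  rw [show 2 * k - 1 - k + 1 = k by omega]
  exact j.isLt

/-- Depth in the binomial tree, negated on the subtree of the child `1` of the root. -/
def signedDepth (j : ℕ) : ℤ :=
  if h : j = 0 then 0 else signedDepth (btParent j) + if j % 2 = 1 then -1 else 1
termination_by j
decreasing_by exact btParent_lt h

theorem abs_signedDepth_sub_of_adj {k : ℕ} {x y : Fin (2 ^ k)} (h : (BT k).Adj x y) :
    |signedDepth x - signedDepth y| ≤ 1 := by
  have key {i j : ℕ} (hj : j ≠ 0) (hij : i = btParent j) :
      |signedDepth i - signedDepth j| ≤ 1 := by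
    rw [signedDepth.eq_def j, dif_neg hj, ← hij]
    split_ifs <;> simp
  rw [BT, SimpleGraph.fromRel_adj] at h
  rcases h.2 with ⟨hy, hxy⟩ | ⟨hx, hyx⟩
  · exact key hy hxy
  · rw [abs_sub_comm]
    exact key hx hyx

theorem signedDepth_two_pow_sub_one (k : ℕ) : signedDepth (2 ^ k - 1) = -k := by
  induction k with
  | zero => simp [signedDepth]
  | succ k ih =>
    have h0 : 0 < 2 ^ k := by positivity
    have h2 : 2 ^ (k + 1) = 2 * 2 ^ k := pow_succ' 2 k
    have hp : btParent (2 ^ (k + 1) - 1) = 2 ^ k - 1 := by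
      rw [btParent_eq_sub (s := k)] <;> omega
    rw [signedDepth, dif_neg (by omega), hp, ih, if_pos (by omega)]
    push_cast
    ring

theorem signedDepth_two_pow_succ_sub_two (k : ℕ) : signedDepth (2 ^ (k + 1) - 2) = k := by
  induction k with
  | zero => simp [signedDepth]
  | succ k ih =>
    have h0 : 0 < 2 ^ k := by positivity
    have h1 : 2 ^ (k + 1) = 2 * 2 ^ k := pow_succ' 2 k
    have h2 : 2 ^ (k + 1 + 1) = 2 * 2 ^ (k + 1) := pow_succ' 2 (k + 1)
    have hp : btParent (2 ^ (k + 1 + 1) - 2) = 2 ^ (k + 1) - 2 := by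
      rw [btParent_eq_sub (s := k + 1)] <;> omega
    rw [signedDepth, dif_neg (by omega), hp, ih, if_neg (by omega)]
    push_cast
    ring

/-- A function that changes by at most one along edges changes by at most the elapsed time
over a broadcast. -/
theorem IsBroadcastScheme.le_add {V : Type*} [DecidableEq V] {G : SimpleGraph V} {v : V}
    {A : ℕ → Finset V} (hA : IsBroadcastScheme G v A) {D : V → ℤ}
    (hD : ∀ x y, G.Adj x y → |D x - D y| ≤ 1) (t : ℕ) :
    ∀ w ∈ A t, D w ≤ D v + t := by
  induction t with
  | zero =>
    intro w hw
    rw [hA.1, Finset.mem_singleton] at hw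
    simp [hw]
  | succ t ih =>
    intro w hw
    push_cast
    by_cases hwt : w ∈ A t
    · linarith [ih w hwt]
    · obtain ⟨-, f, hf, -⟩ := hA.2 t
      obtain ⟨hfA, hadj⟩ := hf w (Finset.mem_sdiff.2 ⟨hw, hwt⟩)
      linarith [ih _ hfA, (abs_le.1 (hD _ _ hadj)).1]

theorem IsBroadcastScheme.two_mul_sub_one_le {k T : ℕ} (hk : 1 ≤ k) {v : Fin (2 ^ k)}
    (hv : (v : ℕ) = 2 ^ k - 1) {A : ℕ → Finset (Fin (2 ^ k))}
    (hA : IsBroadcastScheme (BT k) v A) (hT : A T = Finset.univ) : 2 * k - 1 ≤ T := by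
  obtain ⟨m, rfl⟩ := Nat.exists_eq_add_of_le' hk
  have h0 : 0 < 2 ^ (m + 1) := by positivity
  have h := hA.le_add (D := fun x => signedDepth x) (fun _ _ => abs_signedDepth_sub_of_adj) T
    ⟨2 ^ (m + 1) - 2, by omega⟩ (by simp [hT])
  simp only [hv, signedDepth_two_pow_sub_one, signedDepth_two_pow_succ_sub_two] at h
  push_cast at h
  omega

/-- For every `k ≥ 1`, the broadcast time of the `k`-dimensional
binomial tree is `b(BT k) = 2k - 1`. -/
theorem broadcastTime_BT (k : ℕ) (hk : 1 ≤ k) :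
    broadcastTime (BT k) = 2 * k - 1 := by
  have hmem (v : Fin (2 ^ k)) : 2 * k - 1 ∈
      {T | ∃ A : ℕ → Finset (Fin (2 ^ k)),
        IsBroadcastScheme (BT k) v A ∧ A T = Finset.univ} :=
    ⟨btScheme k v, isBroadcastScheme_btScheme hk v, btScheme_eq_univ hk v⟩
  refine le_antisymm (Finset.sup_le fun v _ => Nat.sInf_le (hmem v)) ?_
  have h0 : 0 < 2 ^ k := by positivity
  refine le_trans ?_ (Finset.le_sup (Finset.mem_univ (⟨2 ^ k - 1, by omega⟩ : Fin (2 ^ k))))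
  refine le_csInf ⟨_, hmem _⟩ ?_
  rintro T ⟨A, hA, hT⟩
  exact hA.two_mul_sub_one_le hk rfl hT
end

section
/- For every k ≥ 2, the Mirrored-Binomial graph MB_k on 2^k vertices is a series-parallel graph (with terminals s and t). -/
/-- Multigraphs (a finite vertex set `V ⊆ ℕ` together with a multiset of edges) obtainable
from the base multigraph `(V₀, E₀)` by a finite sequence of parallel extensions (adding a
new edge parallel to an existing edge) and series extensions (replacing an edge `{u, w}`
by a path `u – x – w` through a new vertex `x`). -/
inductive SPBuildFrom (V₀ : Finset ℕ) (E₀ : Multiset (Sym2 ℕ)) :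
    Finset ℕ → Multiset (Sym2 ℕ) → Prop
  | base : SPBuildFrom V₀ E₀ V₀ E₀
  | parallel {V : Finset ℕ} {E : Multiset (Sym2 ℕ)} (e : Sym2 ℕ) (he : e ∈ E) :
      SPBuildFrom V₀ E₀ V E → SPBuildFrom V₀ E₀ V (e ::ₘ E)
  | series {V : Finset ℕ} {E : Multiset (Sym2 ℕ)} (u w x : ℕ)
      (he : s(u, w) ∈ E) (hx : x ∉ V) :
      SPBuildFrom V₀ E₀ V E →
      SPBuildFrom V₀ E₀ (insert x V) (s(u, x) ::ₘ s(x, w) ::ₘ E.erase s(u, w))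

/-- The simple graph underlying the multigraph `(V, E)`. -/
def underlyingGraph (V : Finset ℕ) (E : Multiset (Sym2 ℕ)) : SimpleGraph {x // x ∈ V} :=
  SimpleGraph.fromRel fun a b => s((a : ℕ), (b : ℕ)) ∈ E

/-- `G` is series-parallel with terminals `a` and `b`. -/
def IsSPWithTerminals {α : Type*} (G : SimpleGraph α) (a b : α) : Prop :=
  ∃ (sv tv : ℕ) (V : Finset ℕ) (E : Multiset (Sym2 ℕ)), sv ≠ tv ∧
    SPBuildFrom {sv, tv} {s(sv, tv)} V E ∧
    ∃ φ : G ≃g underlyingGraph V E,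
      ((φ a : {x // x ∈ V}) : ℕ) = sv ∧ ((φ b : {x // x ∈ V}) : ℕ) = tv

/-- The Mirrored-Binomial graph `MB k` on `2^k` vertices: two disjoint copies
(`false` = upper, rooted at `s = (false, 0)`; `true` = lower, rooted at `t = (true, 0)`)
of the binomial tree `BT (k-1)`, where each leaf (a vertex `≥ 2^(k-2)`) of the upper copy
is joined to the corresponding leaf of the lower copy (the correspondence being the
identity on the second coordinate, an isomorphism of the two trees).
The vertices `s' = (false, 1)` and `t' = (true, 1)` are the roots of the second
`BT (k-2)` of the upper and lower copies respectively. -/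
def MB (k : ℕ) : SimpleGraph (Bool × Fin (2 ^ (k - 1))) :=
  SimpleGraph.fromRel fun a b =>
    (a.1 = b.1 ∧ (b.2 : ℕ) ≠ 0 ∧ (a.2 : ℕ) = btParent (b.2 : ℕ)) ∨
    (a.1 ≠ b.1 ∧ (a.2 : ℕ) = (b.2 : ℕ) ∧ 2 ^ (k - 2) ≤ (a.2 : ℕ))

/-- The edge joining the two copies of vertex `j`, where `(false, j)` is encoded as `2 * j` and
`(true, j)` as `2 * j + 1`. -/
def rung (j : ℕ) : Sym2 ℕ := s(2 * j, 2 * j + 1)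

theorem btParent_of_mem_Ico {n j : ℕ} (h₁ : 2 ^ n ≤ j) (h₂ : j < 2 ^ (n + 1)) :
    btParent j = j - 2 ^ n := by
  rw [btParent, Nat.log_eq_of_pow_le_of_lt_pow h₁ h₂]

/-- A rung can be replaced by a path of length three through two new vertices. -/
theorem SPBuildFrom.subdivide_rung {V₀ : Finset ℕ} {E₀ E : Multiset (Sym2 ℕ)} {p N : ℕ}
    (h : SPBuildFrom V₀ E₀ (Finset.range (2 * N)) (rung p ::ₘ E)) :
    SPBuildFrom V₀ E₀ (Finset.range (2 * (N + 1)))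
      (rung N ::ₘ s(2 * p, 2 * N) ::ₘ s(2 * p + 1, 2 * N + 1) ::ₘ E) := by
  have h₁ := h.series (2 * p) (2 * p + 1) (2 * N) (by simp [rung]) (by simp)
  have h₂ := h₁.series (2 * N) (2 * p + 1) (2 * N + 1) (by simp) (by simp)
  convert h₂ using 1
  · ext x
    simp only [Finset.mem_insert, Finset.mem_range]
    omega
  · rw [Multiset.cons_swap s(2 * p, 2 * N) s(2 * N, 2 * p + 1), Multiset.erase_cons_head,
      show s(2 * p, 2 * p + 1) = rung p from rfl, Multiset.erase_cons_head,
      Multiset.cons_swap s(2 * p, 2 * N), Sym2.eq_swap (a := 2 * p + 1)]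
    rfl

/-- Inserting the vertices of both trees in increasing order: after the first `N` of them, the
rungs present are those at vertices whose last child has not been inserted yet. -/
theorem exists_SPBuildFrom_rungs (n N : ℕ) (h₁ : 1 ≤ N) (h₂ : N ≤ 2 ^ (n + 1)) :
    ∃ T : Multiset (Sym2 ℕ),
      (∀ e, e ∈ T ↔ ∃ j, 1 ≤ j ∧ j < N ∧
        (e = s(2 * btParent j, 2 * j) ∨ e = s(2 * btParent j + 1, 2 * j + 1))) ∧
      SPBuildFrom {0, 1} {s(0, 1)} (Finset.range (2 * N))
        ((Finset.Ico (N - 2 ^ n) N).val.map rung + T) := by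
  induction N, h₁ using Nat.le_induction with
  | base =>
    refine ⟨0, fun e => ?_, ?_⟩
    · simp only [Multiset.notMem_zero, false_iff]
      rintro ⟨j, h, h', -⟩
      omega
    · have hn : 1 - 2 ^ n = 0 := Nat.sub_eq_zero_of_le Nat.one_le_two_pow
      rw [hn]
      exact SPBuildFrom.base
  | succ N hN ih =>
    obtain ⟨T, hT, hB⟩ := ih (by omega)
    refine ⟨s(2 * btParent N, 2 * N) ::ₘ s(2 * btParent N + 1, 2 * N + 1) ::ₘ T, fun e => ?_, ?_⟩
    · simp only [Multiset.mem_cons, hT]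
      constructor
      · rintro (h | h | ⟨j, h, h', h''⟩)
        · exact ⟨N, hN, by omega, .inl h⟩
        · exact ⟨N, hN, by omega, .inr h⟩
        · exact ⟨j, h, by omega, h''⟩
      · rintro ⟨j, h, h', h''⟩
        rcases Nat.lt_succ_iff_lt_or_eq.mp h' with hj | rfl
        · exact .inr (.inr ⟨j, h, hj, h''⟩)
        · tauto
    · have hpN : btParent N < N := btParent_lt (by omega)
      have hpos : 0 < 2 ^ n := by positivity
      rcases lt_or_ge N (2 ^ n) with hlt | hge
      · have hd := (hB.parallel (rung (btParent N)) (by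
          simp only [Multiset.mem_add, Multiset.mem_map]
          exact .inl ⟨btParent N, by simp; omega, rfl⟩)).subdivide_rung
        have hI : Finset.Ico (N + 1 - 2 ^ n) (N + 1) =
            Finset.cons N (Finset.Ico (N - 2 ^ n) N) (by simp) := by
          ext x
          simp only [Finset.mem_cons, Finset.mem_Ico]
          omega
        rw [hI, Finset.cons_val, Multiset.map_cons, Multiset.cons_add,
          Multiset.add_cons, Multiset.add_cons]
        exact hd
      · have hp := btParent_of_mem_Ico hge (by omega)
        have hI : Finset.Ico (N - 2 ^ n) N =
            Finset.cons (btParent N) (Finset.Ico (N + 1 - 2 ^ n) N) (by simp; omega) := by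
          ext x
          simp only [Finset.mem_cons, Finset.mem_Ico]
          omega
        have hI' : Finset.Ico (N + 1 - 2 ^ n) (N + 1) =
            Finset.cons N (Finset.Ico (N + 1 - 2 ^ n) N) (by simp) := by
          ext x
          simp only [Finset.mem_cons, Finset.mem_Ico]
          omega
        rw [hI, Finset.cons_val, Multiset.map_cons, Multiset.cons_add] at hB
        rw [hI', Finset.cons_val, Multiset.map_cons, Multiset.cons_add,
          Multiset.add_cons, Multiset.add_cons]
        exact hB.subdivide_rung

/-- The encoding `(b, j) ↦ 2 * j + b`. -/
def boolFinEquivRange (N : ℕ) : Bool × Fin N ≃ {x // x ∈ Finset.range (2 * N)} where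
  toFun a := ⟨2 * (a.2 : ℕ) + a.1.toNat, by
    have := a.1.toNat_le
    have := a.2.isLt
    rw [Finset.mem_range]
    omega⟩
  invFun x := (decide ((x : ℕ) % 2 = 1), ⟨(x : ℕ) / 2, by
    have := Finset.mem_range.mp x.2
    omega⟩)
  left_inv := by
    rintro ⟨_ | _, j⟩ <;> simp [Fin.ext_iff]; omega
  right_inv := by
    rintro ⟨x, hx⟩
    rcases Nat.mod_two_eq_zero_or_one x with h | h <;> simp [h] <;> omega

/-- For every `k ≥ 2`, the Mirrored-Binomial graph `MB k` on `2^k`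
vertices is a series-parallel graph with terminals `s = (false, 0)` and `t = (true, 0)`. -/
theorem MB_isSP (k : ℕ) (hk : 2 ≤ k) :
    IsSPWithTerminals (MB k) (false, ⟨0, by positivity⟩) (true, ⟨0, by positivity⟩) := by
  obtain ⟨n, rfl⟩ := Nat.exists_eq_add_of_le' hk
  obtain ⟨T, hT, hB⟩ := exists_SPBuildFrom_rungs n (2 ^ (n + 1)) Nat.one_le_two_pow le_rfl
  have hpow : 2 ^ (n + 1) = 2 * 2 ^ n := by ring
  refine ⟨0, 1, _, _, by norm_num, hB, ⟨boolFinEquivRange _, ?_⟩, by rfl, by rfl⟩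
  intro a b
  have key : ∀ a b : Bool × Fin (2 ^ (n + 1)),
      s(2 * (a.2 : ℕ) + a.1.toNat, 2 * (b.2 : ℕ) + b.1.toNat) ∈
        (Finset.Ico (2 ^ (n + 1) - 2 ^ n) (2 ^ (n + 1))).val.map rung + T ↔
      ((a.1 = b.1 ∧ (b.2 : ℕ) ≠ 0 ∧ (a.2 : ℕ) = btParent (b.2 : ℕ)) ∨
        (a.1 ≠ b.1 ∧ (a.2 : ℕ) = (b.2 : ℕ) ∧ 2 ^ n ≤ (a.2 : ℕ))) ∨
      ((b.1 = a.1 ∧ (a.2 : ℕ) ≠ 0 ∧ (b.2 : ℕ) = btParent (a.2 : ℕ)) ∨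
        (b.1 ≠ a.1 ∧ (b.2 : ℕ) = (a.2 : ℕ) ∧ 2 ^ n ≤ (b.2 : ℕ))) := by
    rintro ⟨b₁, i, hi⟩ ⟨b₂, j, hj⟩
    simp only [Multiset.mem_add, Multiset.mem_map, hT, Finset.mem_val, Finset.mem_Ico, rung,
      Sym2.eq_iff]
    constructor
    · rintro (⟨l, hl, h⟩ | ⟨l, hl, hl', h⟩)
      · cases b₁ <;> cases b₂ <;> simp at h ⊢ <;> omega
      · have hcase : (b₁ = b₂ ∧ i = btParent l ∧ j = l) ∨ (b₁ = b₂ ∧ j = btParent l ∧ i = l) := by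
          cases b₁ <;> cases b₂ <;> simp at h ⊢ <;> omega
        rcases hcase with ⟨rfl, h, rfl⟩ | ⟨rfl, h, rfl⟩
        · exact .inl (.inl ⟨rfl, by simp; omega, h⟩)
        · exact .inr (.inl ⟨rfl, by simp; omega, h⟩)
    · rintro ((⟨rfl, h, h'⟩ | ⟨h, h', h''⟩) | (⟨rfl, h, h'⟩ | ⟨h, h', h''⟩))
      · refine .inr ⟨j, Nat.one_le_iff_ne_zero.mpr h, hj, ?_⟩
        cases b₁ <;> simp_all
      · refine .inl ⟨i, by omega, ?_⟩
        cases b₁ <;> cases b₂ <;> simp_all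
      · refine .inr ⟨i, Nat.one_le_iff_ne_zero.mpr h, hi, ?_⟩
        cases b₂ <;> simp_all
      · refine .inl ⟨i, by omega, ?_⟩
        cases b₁ <;> cases b₂ <;> simp_all
  simp only [underlyingGraph, MB, SimpleGraph.fromRel_adj, ne_eq, EmbeddingLike.apply_eq_iff_eq]
  refine and_congr_right fun _ => ?_
  refine Iff.trans ?_ (key a b)
  rw [Sym2.eq_swap (a := ((boolFinEquivRange _ b : _) : ℕ)), or_self]
  rfl
end

section
/- For every n ≥ 5 there exists a simple series-parallel graph on n vertices with maximum degree at most ⌈log₂ n⌉ − 1 and broadcast time at most ⌊(3⌈log₂ n⌉)/2⌋. -/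
/-- A simple graph is series-parallel if it is isomorphic to the underlying simple graph of
a multigraph obtained from a single edge on two terminals by series and parallel
extensions. -/
def IsSP {α : Type*} (G : SimpleGraph α) : Prop :=
  ∃ (sv tv : ℕ) (V : Finset ℕ) (E : Multiset (Sym2 ℕ)), sv ≠ tv ∧
    SPBuildFrom {sv, tv} {s(sv, tv)} V E ∧ Nonempty (G ≃g underlyingGraph V E)

/-- `MirroredBinomial m r r' V E`: the multigraph `(V, E)` consists of two binomial trees of
order `m`, rooted at `r` and `r'`, whose leaves are joined in reverse order; the joining paths
have between one and three edges. -/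
inductive MirroredBinomial : ℕ → ℕ → ℕ → Finset ℕ → Multiset (Sym2 ℕ) → Prop
  | edge {r r' : ℕ} (h : r ≠ r') : MirroredBinomial 1 r r' {r, r'} {s(r, r')}
  | path₂ {r x r' : ℕ} (h : [r, x, r'].Nodup) :
      MirroredBinomial 1 r r' {r, x, r'} {s(r, x), s(x, r')}
  | path₃ {r x x' r' : ℕ} (h : [r, x, x', r'].Nodup) :
      MirroredBinomial 1 r r' {r, x, x', r'} {s(r, x), s(x, x'), s(x', r')}
  | join {m r c c' r' : ℕ} {V₁ V₂ : Finset ℕ} {E₁ E₂ : Multiset (Sym2 ℕ)}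
      (h₁ : MirroredBinomial m r c' V₁ E₁) (h₂ : MirroredBinomial m c r' V₂ E₂)
      (hV : Disjoint V₁ V₂) :
      MirroredBinomial (m + 1) r r' (V₁ ∪ V₂) (s(r, c) ::ₘ s(c', r') ::ₘ (E₁ + E₂))

namespace MirroredBinomial

variable {m r r' : ℕ} {V : Finset ℕ} {E : Multiset (Sym2 ℕ)}

theorem vertices_path₂_swap (r x r' : ℕ) : ({r, x, r'} : Finset ℕ) = {r', x, r} := by
  grind

theorem vertices_path₃_swap (r x x' r' : ℕ) : ({r, x, x', r'} : Finset ℕ) = {r', x', x, r} := by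
  grind

theorem edges_path₂_swap (r x r' : ℕ) :
    ({s(r, x), s(x, r')} : Multiset (Sym2 ℕ)) = {s(r', x), s(x, r)} := by
  rw [Multiset.pair_comm, Sym2.eq_swap, Sym2.eq_swap (a := r)]

theorem edges_path₃_swap (r x x' r' : ℕ) :
    ({s(r, x), s(x, x'), s(x', r')} : Multiset (Sym2 ℕ)) = {s(r', x'), s(x', x), s(x, r)} := by
  rw [Sym2.eq_swap (a := r'), Sym2.eq_swap (a := x') (b := x), Sym2.eq_swap (a := x) (b := r)]
  ext
  simp [Multiset.count_cons, Multiset.count_singleton]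
  omega

theorem edges_join_swap (r c c' r' : ℕ) (E₁ E₂ : Multiset (Sym2 ℕ)) :
    s(r, c) ::ₘ s(c', r') ::ₘ (E₁ + E₂) = s(r', c') ::ₘ s(c, r) ::ₘ (E₂ + E₁) := by
  rw [add_comm E₂, Multiset.cons_swap, Sym2.eq_swap, Sym2.eq_swap (a := r)]

theorem symm (h : MirroredBinomial m r r' V E) : MirroredBinomial m r' r V E := by
  induction h with
  | edge h =>
    rw [Finset.pair_comm, Sym2.eq_swap]
    exact edge h.symm
  | path₂ h =>
    rw [vertices_path₂_swap, edges_path₂_swap]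
    exact path₂ (by grind)
  | path₃ h =>
    rw [vertices_path₃_swap, edges_path₃_swap]
    exact path₃ (by grind)
  | join _ _ hV h₁ h₂ =>
    rw [Finset.union_comm, edges_join_swap]
    exact join h₂ h₁ hV.symm

theorem one_le (h : MirroredBinomial m r r' V E) : 1 ≤ m := by
  induction h <;> omega

theorem left_mem (h : MirroredBinomial m r r' V E) : r ∈ V := by
  induction h <;> simp_all

theorem right_mem (h : MirroredBinomial m r r' V E) : r' ∈ V :=
  h.symm.left_mem

theorem ne (h : MirroredBinomial m r r' V E) : r ≠ r' := by
  induction h with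
  | join h₁ h₂ hV =>
    exact fun h => Finset.disjoint_left.1 hV h₁.left_mem (h ▸ h₂.right_mem)
  | _ => simp_all

theorem mem_of_edge (h : MirroredBinomial m r r' V E) {u w : ℕ} (he : s(u, w) ∈ E) :
    u ∈ V ∧ w ∈ V := by
  induction h with
  | join h₁ h₂ hV ih₁ ih₂ =>
    have := h₁.left_mem
    have := h₁.right_mem
    have := h₂.left_mem
    have := h₂.right_mem
    simp only [Multiset.mem_cons, Multiset.mem_add, Sym2.eq_iff, Finset.mem_union] at he ⊢
    grind
  | _ =>
    simp only [Multiset.mem_cons, Multiset.insert_eq_cons, Multiset.mem_singleton, Sym2.eq_iff,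
      Finset.mem_insert, Finset.mem_singleton] at he ⊢
    grind

theorem countP_eq_zero (h : MirroredBinomial m r r' V E) {u : ℕ} (hu : u ∉ V) :
    E.countP (u ∈ ·) = 0 := by
  rw [Multiset.countP_eq_zero]
  intro e he hue
  induction e with
  | h x y =>
    have := h.mem_of_edge he
    rw [Sym2.mem_iff] at hue
    grind

theorem countP_left_le (h : MirroredBinomial m r r' V E) : E.countP (r ∈ ·) ≤ m := by
  induction h with
  | @join m r c c' r' V₁ V₂ E₁ E₂ h₁ h₂ hV ih₁ ih₂ =>
    have h0 := h₂.countP_eq_zero (Finset.disjoint_left.1 hV h₁.left_mem)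
    have hc := h₁.ne
    have hr : r ≠ r' := (join h₁ h₂ hV).ne
    simp only [Multiset.countP_cons, Multiset.countP_add, Sym2.mem_iff]
    simp [hc, hr]
    omega
  | edge => simp [← Multiset.cons_zero]
  | path₂ h => simp_all [← Multiset.cons_zero]
  | path₃ h => simp_all [← Multiset.cons_zero]

theorem countP_le (h : MirroredBinomial m r r' V E) (u : ℕ) :
    E.countP (u ∈ ·) ≤ max m 2 := by
  induction h with
  | @join m r c c' r' V₁ V₂ E₁ E₂ h₁ h₂ hV ih₁ ih₂ =>
    by_cases hr : u = r
    · subst hr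
      exact (join h₁ h₂ hV).countP_left_le.trans (le_max_left _ _)
    by_cases hr' : u = r'
    · subst hr'
      exact (join h₁ h₂ hV).symm.countP_left_le.trans (le_max_left _ _)
    have hm₁ := h₁.symm.countP_left_le
    have hm₂ := h₂.countP_left_le
    have hd : u ∈ V₁ → u ∉ V₂ := fun hu => Finset.disjoint_left.1 hV hu
    have hz₁ := h₁.countP_eq_zero (u := u)
    have hz₂ := h₂.countP_eq_zero (u := u)
    simp only [Multiset.countP_cons, Multiset.countP_add, Sym2.mem_iff, hr, hr', false_or, or_false]
    by_cases hu : u ∈ V₁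
    · have hc : u ≠ c := fun h => hd hu (h ▸ h₂.left_mem)
      rw [hz₂ (hd hu), if_neg hc]
      split_ifs with hc'
      · subst hc'
        omega
      · omega
    · have hc' : u ≠ c' := fun h => hu (h ▸ h₁.right_mem)
      rw [hz₁ hu, if_neg hc']
      split_ifs with hc
      · subst hc
        omega
      · omega
  | edge => simp [← Multiset.cons_zero, Multiset.countP_cons]; grind
  | path₂ h => simp_all [← Multiset.cons_zero, Multiset.countP_cons]; grind
  | path₃ h => simp_all [← Multiset.cons_zero, Multiset.countP_cons]; grind

end MirroredBinomial

theorem exists_mirroredBinomial {m : ℕ} (hm : 1 ≤ m) {n : ℕ} (h₁ : 2 ^ m ≤ n)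
    (h₂ : n ≤ 2 ^ (m + 1)) (N : ℕ) :
    ∃ r r' E, MirroredBinomial m r r' (Finset.Ico N (N + n)) E := by
  induction m, hm using Nat.le_induction generalizing n N with
  | base =>
    have : n = 2 ∨ n = 3 ∨ n = 4 := by omega
    rcases this with rfl | rfl | rfl
    · refine ⟨N, N + 1, {s(N, N + 1)}, ?_⟩
      rw [show Finset.Ico N (N + 2) = {N, N + 1} by ext; simp; omega]
      exact .edge (by omega)
    · refine ⟨N, N + 2, {s(N, N + 1), s(N + 1, N + 2)}, ?_⟩
      rw [show Finset.Ico N (N + 3) = {N, N + 1, N + 2} by ext; simp; omega]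
      exact .path₂ (by simp)
    · refine ⟨N, N + 3, {s(N, N + 1), s(N + 1, N + 2), s(N + 2, N + 3)}, ?_⟩
      rw [show Finset.Ico N (N + 4) = {N, N + 1, N + 2, N + 3} by ext; simp; omega]
      exact .path₃ (by simp)
  | succ m hm ih =>
    rw [pow_succ] at h₁ h₂
    obtain ⟨r, c', E₁, hA⟩ := ih (n := n / 2) (by omega) (by omega) N
    obtain ⟨c, r', E₂, hB⟩ := ih (n := n - n / 2) (by omega) (by omega) (N + n / 2)
    rw [show N + n / 2 + (n - n / 2) = N + n by omega] at hB
    refine ⟨r, r', s(r, c) ::ₘ s(c', r') ::ₘ (E₁ + E₂), ?_⟩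
    rw [← Finset.Ico_union_Ico_eq_Ico (b := N + n / 2) (by omega) (by omega)]
    exact .join hA hB (Finset.Ico_disjoint_Ico_consecutive _ _ _)

theorem SPBuildFrom.subset {V₀ V : Finset ℕ} {E₀ E : Multiset (Sym2 ℕ)}
    (h : SPBuildFrom V₀ E₀ V E) : V₀ ⊆ V := by
  induction h with
  | base => rfl
  | parallel _ _ _ ih => exact ih
  | series _ _ x _ _ _ ih => exact ih.trans (Finset.subset_insert _ _)

/-- Replacing an edge of a series-parallel multigraph by a series-parallel multigraph whose
terminals are the ends of that edge. -/
theorem SPBuildFrom.replace_edge {V₀ V₁ V : Finset ℕ} {E₀ F E : Multiset (Sym2 ℕ)} {a b : ℕ}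
    (h₁ : SPBuildFrom V₀ E₀ V₁ (s(a, b) ::ₘ F)) (ha : a ∈ V₁) (hb : b ∈ V₁)
    (h : SPBuildFrom {a, b} {s(a, b)} V E) (hV : V₁ ∩ V ⊆ {a, b}) :
    SPBuildFrom V₀ E₀ (V₁ ∪ V) (E + F) := by
  induction h with
  | base =>
    rw [Finset.union_eq_left.2 (by simp [Finset.insert_subset_iff, ha, hb])]
    exact h₁
  | parallel e he _ ih =>
    rw [Multiset.cons_add]
    exact .parallel e (Multiset.mem_add.2 (.inl he)) (ih hV)
  | @series V E u w x he hx h ih =>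
    have hsub := h.subset
    have hx₁ : x ∉ V₁ := fun hx₁ =>
      hx (hsub (hV (Finset.mem_inter.2 ⟨hx₁, Finset.mem_insert_self _ _⟩)))
    have := ih ((Finset.inter_subset_inter_left (Finset.subset_insert _ _)).trans hV)
    have := SPBuildFrom.series u w x (Multiset.mem_add.2 (.inl he)) (by simp [hx, hx₁]) this
    rwa [Finset.union_insert, Multiset.cons_add, Multiset.cons_add,
      ← Multiset.erase_add_left_pos _ he]

theorem MirroredBinomial.spBuildFrom {m r r' : ℕ} {V : Finset ℕ} {E : Multiset (Sym2 ℕ)}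
    (h : MirroredBinomial m r r' V E) : SPBuildFrom {r, r'} {s(r, r')} V E := by
  induction h with
  | edge => exact .base
  | @path₂ r x r' h =>
    have := SPBuildFrom.series (V₀ := {r, r'}) (E₀ := {s(r, r')}) r r' x (by simp)
      (by simp at h ⊢; tauto) .base
    convert this using 1
    · ext; simp; tauto
    · simp
  | @path₃ r x x' r' h =>
    have := SPBuildFrom.series (V₀ := {r, r'}) (E₀ := {s(r, r')}) r r' x (by simp)
      (by simp at h ⊢; tauto) .base
    have := SPBuildFrom.series x r' x' (by simp) (by simp at h ⊢; grind) this
    convert this using 1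
    · ext; simp; tauto
    · simp [Multiset.erase_cons_tail_of_mem]
      rw [← Multiset.cons_zero, Multiset.cons_swap, ← Multiset.cons_zero,
        Multiset.cons_swap (s(r, x))]
  | @join m r c c' r' V₁ V₂ E₁ E₂ h₁ h₂ hV ih₁ ih₂ =>
    have hd := fun x (hx : x ∈ V₁) => Finset.disjoint_left.1 hV hx
    have hr := h₁.left_mem
    have hc' := h₁.right_mem
    have hc := h₂.left_mem
    have hr' := h₂.right_mem
    have := h₁.ne
    have := h₂.ne
    have h := SPBuildFrom.parallel (V₀ := {r, r'}) (E₀ := {s(r, r')}) s(r, r') (by simp) .base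
    have h := SPBuildFrom.series r r' c' (by simp) (by simp; grind) h
    have h := SPBuildFrom.series r r' c (by simp) (by simp; grind) h
    have h : SPBuildFrom {r, r'} {s(r, r')} {c, c', r, r'}
        (s(r, c') ::ₘ s(c, r') ::ₘ s(r, c) ::ₘ {s(c', r')}) := by
      convert h using 1
      rw [Multiset.erase_cons_head, Multiset.erase_cons_tail _ (by simp; grind),
        Multiset.erase_cons_tail _ (by simp; grind), Multiset.erase_singleton]
      ext
      simp [Multiset.count_cons, Multiset.count_singleton]
      omega
    have h := h.replace_edge (by simp) (by simp) ih₁ (by intro x; simp; grind)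
    rw [Multiset.add_cons] at h
    have h := h.replace_edge (by simp) (by simp) ih₂ (by intro x; simp; grind)
    convert h using 1
    · ext; simp; grind
    · ext; simp [Multiset.count_cons, Multiset.count_singleton]; omega

/-- In the plan with calls `C`, the vertex `w` is called before time `τ`. -/
def CalledBefore (C : ℕ → ℕ → ℕ → Prop) (τ w : ℕ) : Prop :=
  ∃ u σ, σ < τ ∧ C u w σ

theorem CalledBefore.mono {C : ℕ → ℕ → ℕ → Prop} {τ τ' w : ℕ} (h : CalledBefore C τ w)
    (hτ : τ ≤ τ') : CalledBefore C τ' w := by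
  obtain ⟨u, σ, hσ, h⟩ := h
  exact ⟨u, σ, hσ.trans_le hτ, h⟩

/-- The union of two plans and two further calls. -/
theorem exists_union_calls (C₁ C₂ : ℕ → ℕ → ℕ → Prop) (u₁ w₁ τ₁ u₂ w₂ τ₂ : ℕ) :
    ∃ C : ℕ → ℕ → ℕ → Prop,
      (∀ u w τ, C u w τ ↔ C₁ u w τ ∨ C₂ u w τ ∨ (u = u₁ ∧ w = w₁ ∧ τ = τ₁) ∨
        (u = u₂ ∧ w = w₂ ∧ τ = τ₂)) ∧
      ∀ τ w, CalledBefore C τ w ↔ CalledBefore C₁ τ w ∨ CalledBefore C₂ τ w ∨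
        (w = w₁ ∧ τ₁ < τ) ∨ (w = w₂ ∧ τ₂ < τ) := by
  refine ⟨_, fun _ _ _ => Iff.rfl, fun τ w => ?_⟩
  simp only [CalledBefore, and_or_left, exists_or]
  simp [and_comm]

/-- `IsCallPlan E S C`: the calls "`u` informs `w` at time `τ`", for `C u w τ`, run along edges
of `E`, every vertex makes at most one call at a time, and a caller outside `S` has been called
before. -/
structure IsCallPlan (E : Multiset (Sym2 ℕ)) (S : Set ℕ) (C : ℕ → ℕ → ℕ → Prop) : Prop where
  mem_edges : ∀ u w τ, C u w τ → s(u, w) ∈ E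
  pos : ∀ u w τ, C u w τ → 0 < τ
  unique : ∀ u w w' τ, C u w τ → C u w' τ → w = w'
  informed : ∀ u w τ, C u w τ → u ∈ S ∨ CalledBefore C τ u

namespace MirroredBinomial

variable {m r r' : ℕ} {V : Finset ℕ} {E : Multiset (Sym2 ℕ)}

theorem exists_callPlan_left (h : MirroredBinomial m r r' V E) (a : ℕ) :
    ∃ C, IsCallPlan E {r} C ∧ (∀ w τ, C r w τ → a < τ) ∧ (∀ w τ, ¬ C r' w τ) ∧
      ∀ w ∈ V, w = r ∨ CalledBefore C (a + m + 2 + 1) w := by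
  induction h generalizing a with
  | @edge r r' h =>
    refine ⟨fun u w τ => u = r ∧ w = r' ∧ τ = a + 1, ⟨?_, ?_, ?_, ?_⟩, ?_, ?_, ?_⟩ <;>
      simp [CalledBefore] <;> grind
  | @path₂ r x r' h =>
    refine ⟨fun u w τ => (u = r ∧ w = x ∧ τ = a + 1) ∨ (u = x ∧ w = r' ∧ τ = a + 2),
      ⟨?_, ?_, ?_, ?_⟩, ?_, ?_, ?_⟩ <;> simp [CalledBefore, and_or_left, exists_or] at h ⊢ <;> grind
  | @path₃ r x x' r' h =>
    refine ⟨fun u w τ => (u = r ∧ w = x ∧ τ = a + 1) ∨ (u = x ∧ w = x' ∧ τ = a + 2) ∨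
      (u = x' ∧ w = r' ∧ τ = a + 3), ⟨?_, ?_, ?_, ?_⟩, ?_, ?_, ?_⟩ <;>
      simp [CalledBefore, and_or_left, exists_or] at h ⊢ <;> grind
  | @join m r c c' r' V₁ V₂ E₁ E₂ h₁ h₂ hV ih₁ ih₂ =>
    obtain ⟨C₁, p₁, hr, hc', hC₁⟩ := ih₁ (a + 1)
    obtain ⟨C₂, p₂, hc, hr', hC₂⟩ := ih₂ (a + 1)
    have hd := fun x (hx : x ∈ V₁) => Finset.disjoint_left.1 hV hx
    have e₁ := fun u w τ h => h₁.mem_of_edge (p₁.mem_edges u w τ h)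
    have e₂ := fun u w τ h => h₂.mem_of_edge (p₂.mem_edges u w τ h)
    have := h₁.left_mem
    have := h₁.right_mem
    have := h₂.left_mem
    have := h₂.right_mem
    have := h₁.ne
    have := h₂.ne
    obtain ⟨m₁, q₁, u₁, i₁⟩ := p₁
    obtain ⟨m₂, q₂, u₂, i₂⟩ := p₂
    have mono := @CalledBefore.mono
    simp only [Set.mem_singleton_iff] at i₁ i₂
    obtain ⟨C, hC, hB⟩ := exists_union_calls C₁ C₂ r c (a + 1) r c (a + 1)
    refine ⟨C, ⟨?_, ?_, ?_, ?_⟩, ?_, ?_, ?_⟩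
    · simp; grind
    · grind
    · grind
    · simp only [Set.mem_singleton_iff]; grind
    · grind
    · grind
    · simp; grind

theorem exists_callPlan (h : MirroredBinomial m r r' V E) {a a' D : ℕ} (ha : a + m ≤ D + 1)
    (ha' : a' + m ≤ D + 1) (haa' : a + a' + 2 * m ≤ 2 * D) :
    ∃ C, IsCallPlan E {r, r'} C ∧ (∀ w τ, C r w τ → a < τ) ∧ (∀ w τ, C r' w τ → a' < τ) ∧
      ∀ w ∈ V, w = r ∨ w = r' ∨ CalledBefore C (D + 1) w := by
  induction h generalizing a a' with
  | @edge r r' h =>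
    refine ⟨fun _ _ _ => False, ⟨?_, ?_, ?_, ?_⟩, ?_, ?_, ?_⟩ <;> simp
  | @path₂ r x r' h =>
    rcases le_or_gt (a + 1) D with hD | hD
    · refine ⟨fun u w τ => u = r ∧ w = x ∧ τ = a + 1, ⟨?_, ?_, ?_, ?_⟩, ?_, ?_, ?_⟩ <;>
        simp [CalledBefore, and_or_left] at h ⊢ <;> grind
    · refine ⟨fun u w τ => u = r' ∧ w = x ∧ τ = a' + 1, ⟨?_, ?_, ?_, ?_⟩, ?_, ?_, ?_⟩ <;>
        simp [CalledBefore, and_or_left] at h ⊢ <;> grind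
  | @path₃ r x x' r' h =>
    rcases le_or_gt (a + 2) D with hD | hD
    · refine ⟨fun u w τ => (u = r ∧ w = x ∧ τ = a + 1) ∨ (u = x ∧ w = x' ∧ τ = a + 2),
        ⟨?_, ?_, ?_, ?_⟩, ?_, ?_, ?_⟩ <;>
        simp [CalledBefore, and_or_left, exists_or] at h ⊢ <;> grind
    rcases le_or_gt (a' + 2) D with hD' | hD'
    · refine ⟨fun u w τ => (u = r' ∧ w = x' ∧ τ = a' + 1) ∨ (u = x' ∧ w = x ∧ τ = a' + 2),
        ⟨?_, ?_, ?_, ?_⟩, ?_, ?_, ?_⟩ <;>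
        simp [CalledBefore, and_or_left, exists_or] at h ⊢ <;> grind
    · refine ⟨fun u w τ => (u = r ∧ w = x ∧ τ = a + 1) ∨ (u = r' ∧ w = x' ∧ τ = a' + 1),
        ⟨?_, ?_, ?_, ?_⟩, ?_, ?_, ?_⟩ <;>
        simp [CalledBefore, and_or_left, exists_or] at h ⊢ <;> grind
  | @join m r c c' r' V₁ V₂ E₁ E₂ h₁ h₂ hV ih₁ ih₂ =>
    obtain ⟨C₁, p₁, hr, hc', hC₁⟩ :=
      ih₁ (a := a + 1) (a' := a' + 1) (by omega) (by omega) (by omega)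
    obtain ⟨C₂, p₂, hc, hr', hC₂⟩ :=
      ih₂ (a := a + 1) (a' := a' + 1) (by omega) (by omega) (by omega)
    have hm : 1 ≤ m := h₁.one_le
    have hd := fun x (hx : x ∈ V₁) => Finset.disjoint_left.1 hV hx
    have e₁ := fun u w τ h => h₁.mem_of_edge (p₁.mem_edges u w τ h)
    have e₂ := fun u w τ h => h₂.mem_of_edge (p₂.mem_edges u w τ h)
    have := h₁.left_mem
    have := h₁.right_mem
    have := h₂.left_mem
    have := h₂.right_mem
    have := h₁.ne
    have := h₂.ne
    obtain ⟨m₁, q₁, u₁, i₁⟩ := p₁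
    obtain ⟨m₂, q₂, u₂, i₂⟩ := p₂
    have mono := @CalledBefore.mono
    simp only [Set.mem_insert_iff, Set.mem_singleton_iff] at i₁ i₂
    obtain ⟨C, hC, hB⟩ := exists_union_calls C₁ C₂ r c (a + 1) r' c' (a' + 1)
    refine ⟨C, ⟨?_, ?_, ?_, ?_⟩, ?_, ?_, ?_⟩
    · simp; grind
    · grind
    · grind
    · simp only [Set.mem_insert_iff, Set.mem_singleton_iff]; grind
    · grind
    · grind
    · simp; grind

/-- A call plan with single originator `v` that keeps the roots `r` and `r'` free for `δ` time
units once they are informed, which happens no later than at times `a` and `a'`. -/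
structure IsOriginPlan (r r' : ℕ) (V : Finset ℕ) (E : Multiset (Sym2 ℕ)) (v a a' δ D : ℕ)
    (C : ℕ → ℕ → ℕ → Prop) : Prop extends IsCallPlan E {v} C where
  left_informed : r = v ∨ CalledBefore C (a + 1) r
  right_informed : r' = v ∨ CalledBefore C (a' + 1) r'
  left_free : ∀ w τ, C r w τ → τ ≤ a ∨ a + δ < τ
  right_free : ∀ w τ, C r' w τ → τ ≤ a' ∨ a' + δ < τ
  covers : ∀ w ∈ V, w = v ∨ CalledBefore C (D + 1) w

theorem IsOriginPlan.symm {v a a' δ D : ℕ} {C : ℕ → ℕ → ℕ → Prop}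
    (h : IsOriginPlan r r' V E v a a' δ D C) : IsOriginPlan r' r V E v a' a δ D C :=
  ⟨h.1, h.3, h.2, h.5, h.4, h.6⟩

/-- From an originator `v`, the roots can be informed at times with sum at most `m + 3`, and
then everything else in about `m + (m + 3) / 2` time units. -/
def HasOriginPlans (m r r' : ℕ) (V : Finset ℕ) (E : Multiset (Sym2 ℕ)) (v : ℕ) : Prop :=
  ∃ a a', 1 ≤ a ∧ 1 ≤ a' ∧ a + a' ≤ m + 3 ∧
    ∀ δ D, 3 * m + 2 * δ + 2 ≤ 2 * D → ∃ C, IsOriginPlan r r' V E v a a' δ D C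

theorem HasOriginPlans.symm {v : ℕ} (h : HasOriginPlans m r r' V E v) :
    HasOriginPlans m r' r V E v := by
  obtain ⟨a, a', ha, ha', hs, h⟩ := h
  exact ⟨a', a, ha', ha, by omega, fun δ D hD => (h δ D hD).imp fun C hC => hC.symm⟩

theorem hasOriginPlans_join_left {c c' v : ℕ} {V₁ V₂ : Finset ℕ} {E₁ E₂ : Multiset (Sym2 ℕ)}
    (h₁ : MirroredBinomial m r c' V₁ E₁) (h₂ : MirroredBinomial m c r' V₂ E₂)
    (hV : Disjoint V₁ V₂) (h : HasOriginPlans m r c' V₁ E₁ v) :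
    HasOriginPlans (m + 1) r r' (V₁ ∪ V₂) (s(r, c) ::ₘ s(c', r') ::ₘ (E₁ + E₂)) v := by
  have hm : 1 ≤ m := h₁.one_le
  obtain ⟨a, a', ha, ha', hs, h⟩ := h
  refine ⟨a, a' + 1, ha, by omega, by omega, fun δ D hD => ?_⟩
  obtain ⟨C₁, p₁, lr, rr, lf, rf, hC₁⟩ := h (δ + 1) D (by omega)
  have : ∃ C, IsCallPlan E₂ {c, r'} C ∧ (∀ w τ, C c w τ → a + δ + 1 < τ) ∧
      (∀ w τ, C r' w τ → a' + δ + 1 < τ) ∧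
      ∀ w ∈ V₂, w = c ∨ w = r' ∨ CalledBefore C (D + 1) w := by
    rcases le_or_gt (a + δ + 3 + m) D with h3 | h3
    · obtain ⟨C, p, hc, hr', hC⟩ := h₂.exists_callPlan_left (a + δ + 1)
      refine ⟨C, ⟨p.1, p.2, p.3, fun u w τ h => (p.4 u w τ h).imp_left (by simp +contextual)⟩,
        hc, fun w τ h => (hr' w τ h).elim, fun w hw =>
          (hC w hw).imp_right fun h => .inr (h.mono (by omega))⟩
    rcases le_or_gt (a' + δ + 3 + m) D with h3' | h3'
    · obtain ⟨C, p, hc, hr', hC⟩ := h₂.symm.exists_callPlan_left (a' + δ + 1)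
      refine ⟨C, ⟨p.1, p.2, p.3, fun u w τ h => (p.4 u w τ h).imp_left (by simp +contextual)⟩,
        fun w τ h => (hr' w τ h).elim, hc, fun w hw =>
          .inr ((hC w hw).imp_right fun h => h.mono (by omega))⟩
    exact h₂.exists_callPlan (by omega) (by omega) (by omega)
  obtain ⟨C₂, p₂, hc, hr', hC₂⟩ := this
  have hd := fun x (hx : x ∈ V₁) => Finset.disjoint_left.1 hV hx
  have e₁ := fun u w τ h => h₁.mem_of_edge (p₁.mem_edges u w τ h)
  have e₂ := fun u w τ h => h₂.mem_of_edge (p₂.mem_edges u w τ h)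
  have := h₁.left_mem
  have := h₁.right_mem
  have := h₂.left_mem
  have := h₂.right_mem
  have := h₁.ne
  have := h₂.ne
  obtain ⟨m₁, q₁, u₁, i₁⟩ := p₁
  obtain ⟨m₂, q₂, u₂, i₂⟩ := p₂
  have mono := @CalledBefore.mono
  simp only [Set.mem_insert_iff, Set.mem_singleton_iff] at i₁ i₂
  obtain ⟨C, hC, hB⟩ := exists_union_calls C₁ C₂ r c (a + δ + 1) c' r' (a' + 1)
  refine ⟨C, ⟨?_, ?_, ?_, ?_⟩, ?_, ?_, ?_, ?_, ?_⟩
  · simp; grind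
  · grind
  · grind
  · rintro u w τ h
    rw [Set.mem_singleton_iff, hB]
    rcases (hC u w τ).1 h with h | h | ⟨rfl, -, rfl⟩ | ⟨rfl, -, rfl⟩
    · exact (i₁ u w τ h).imp_right .inl
    · grind
    · exact lr.imp_right fun h => .inl (h.mono (by omega))
    · exact rr.imp_right .inl
  · grind
  · grind
  · grind
  · grind
  · simp; grind

theorem hasOriginPlans_edge (h : r ≠ r') : HasOriginPlans 1 r r' {r, r'} {s(r, r')} r := by
  refine ⟨1, 1, le_rfl, le_rfl, by omega, fun δ D hD =>
    ⟨fun u w τ => u = r ∧ w = r' ∧ τ = 1, ⟨?_, ?_, ?_, ?_⟩, ?_, ?_, ?_, ?_, ?_⟩⟩ <;>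
    simp [CalledBefore] <;> grind

theorem hasOriginPlans_path₂_left {x : ℕ} (h : [r, x, r'].Nodup) :
    HasOriginPlans 1 r r' {r, x, r'} {s(r, x), s(x, r')} r := by
  refine ⟨1, 2, le_rfl, by omega, by omega, fun δ D hD =>
    ⟨fun u w τ => (u = r ∧ w = x ∧ τ = 1) ∨ (u = x ∧ w = r' ∧ τ = 2),
      ⟨?_, ?_, ?_, ?_⟩, ?_, ?_, ?_, ?_, ?_⟩⟩ <;>
      simp [CalledBefore, and_or_left, exists_or] at h ⊢ <;> grind

theorem hasOriginPlans_path₂_middle {x : ℕ} (h : [r, x, r'].Nodup) :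
    HasOriginPlans 1 r r' {r, x, r'} {s(r, x), s(x, r')} x := by
  refine ⟨1, 2, le_rfl, by omega, by omega, fun δ D hD =>
    ⟨fun u w τ => (u = x ∧ w = r ∧ τ = 1) ∨ (u = x ∧ w = r' ∧ τ = 2),
      ⟨?_, ?_, ?_, ?_⟩, ?_, ?_, ?_, ?_, ?_⟩⟩ <;>
      simp [CalledBefore, and_or_left, exists_or] at h ⊢ <;> grind

theorem hasOriginPlans_path₃_left {x x' : ℕ} (h : [r, x, x', r'].Nodup) :
    HasOriginPlans 1 r r' {r, x, x', r'} {s(r, x), s(x, x'), s(x', r')} r := by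
  refine ⟨1, 3, le_rfl, by omega, by omega, fun δ D hD =>
    ⟨fun u w τ => (u = r ∧ w = x ∧ τ = 1) ∨ (u = x ∧ w = x' ∧ τ = 2) ∨
      (u = x' ∧ w = r' ∧ τ = 3),
      ⟨?_, ?_, ?_, ?_⟩, ?_, ?_, ?_, ?_, ?_⟩⟩ <;>
      simp [CalledBefore, and_or_left, exists_or] at h ⊢ <;> grind

theorem hasOriginPlans_path₃_middle {x x' : ℕ} (h : [r, x, x', r'].Nodup) :
    HasOriginPlans 1 r r' {r, x, x', r'} {s(r, x), s(x, x'), s(x', r')} x := by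
  refine ⟨1, 3, le_rfl, by omega, by omega, fun δ D hD =>
    ⟨fun u w τ => (u = x ∧ w = r ∧ τ = 1) ∨ (u = x ∧ w = x' ∧ τ = 2) ∨
      (u = x' ∧ w = r' ∧ τ = 3),
      ⟨?_, ?_, ?_, ?_⟩, ?_, ?_, ?_, ?_, ?_⟩⟩ <;>
      simp [CalledBefore, and_or_left, exists_or] at h ⊢ <;> grind

end MirroredBinomial

theorem MirroredBinomial.hasOriginPlans {m r r' : ℕ} {V : Finset ℕ} {E : Multiset (Sym2 ℕ)}
    (h : MirroredBinomial m r r' V E) {v : ℕ} (hv : v ∈ V) : HasOriginPlans m r r' V E v := by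
  induction h with
  | @edge r r' h =>
    obtain rfl | rfl : v = r ∨ v = r' := by simpa using hv
    · exact hasOriginPlans_edge h
    · rw [Finset.pair_comm, Sym2.eq_swap]
      exact (hasOriginPlans_edge h.symm).symm
  | @path₂ r x r' h =>
    obtain rfl | rfl | rfl : v = r ∨ v = x ∨ v = r' := by simpa using hv
    · exact hasOriginPlans_path₂_left h
    · exact hasOriginPlans_path₂_middle h
    · rw [vertices_path₂_swap, edges_path₂_swap]
      exact (hasOriginPlans_path₂_left (by grind)).symm
  | @path₃ r x x' r' h =>
    obtain rfl | rfl | rfl | rfl : v = r ∨ v = x ∨ v = x' ∨ v = r' := by simpa using hv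
    · exact hasOriginPlans_path₃_left h
    · exact hasOriginPlans_path₃_middle h
    · rw [vertices_path₃_swap, edges_path₃_swap]
      exact (hasOriginPlans_path₃_middle (by grind)).symm
    · rw [vertices_path₃_swap, edges_path₃_swap]
      exact (hasOriginPlans_path₃_left (by grind)).symm
  | join h₁ h₂ hV ih₁ ih₂ =>
    rcases Finset.mem_union.1 hv with hv | hv
    · exact hasOriginPlans_join_left h₁ h₂ hV (ih₁ hv)
    · rw [Finset.union_comm, edges_join_swap]
      exact (hasOriginPlans_join_left h₂.symm h₁.symm hV.symm (ih₂ hv).symm).symm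

theorem exists_broadcastScheme {n v T : ℕ} {E : Multiset (Sym2 ℕ)} {C : ℕ → ℕ → ℕ → Prop}
    (hv : v < n) (hE : ∀ u w, s(u, w) ∈ E → u < n) (hC : IsCallPlan E {v} C)
    (hT : ∀ w < n, w = v ∨ CalledBefore C (T + 1) w) :
    ∃ A : ℕ → Finset (Fin n),
      IsBroadcastScheme (SimpleGraph.fromRel fun a b : Fin n => s((a : ℕ), (b : ℕ)) ∈ E)
        ⟨v, hv⟩ A ∧ A T = Finset.univ := by
  classical
  refine ⟨fun i => Finset.univ.filter fun w => (w : ℕ) = v ∨ CalledBefore C (i + 1) w,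
    ⟨?_, fun i => ⟨?_, ?_⟩⟩, ?_⟩
  · ext w
    have : ¬ CalledBefore C 1 w := fun ⟨u, σ, hσ, h⟩ => by
      have := hC.pos _ _ _ h
      omega
    simp [this, Fin.ext_iff]
  · intro w
    simp only [Finset.mem_filter, Finset.mem_univ, true_and]
    exact Or.imp_right fun h => h.mono (by omega)
  · have key (w : Fin n) : ∃ u : Fin n,
        ((w : ℕ) = v ∨ CalledBefore C (i + 2) w) → ¬ ((w : ℕ) = v ∨ CalledBefore C (i + 1) w) →
          C u w (i + 1) := by
      by_cases h : CalledBefore C (i + 2) w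
      · obtain ⟨u, σ, hσ, hu⟩ := h
        refine ⟨⟨u, hE _ _ (hC.mem_edges _ _ _ hu)⟩, fun _ h => ?_⟩
        have : σ = i + 1 := by
          by_contra hne
          exact h (.inr ⟨u, σ, by omega, hu⟩)
        exact this ▸ hu
      · exact ⟨w, by tauto⟩
    choose f hf using key
    refine ⟨f, fun w hw => ?_, fun w hw w' hw' h => ?_⟩
    · simp only [Finset.mem_sdiff, Finset.mem_filter, Finset.mem_univ, true_and] at hw ⊢
      have hc := hf w hw.1 hw.2
      have hi := hC.informed _ _ _ hc
      refine ⟨hi, ?_⟩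
      rw [SimpleGraph.fromRel_adj]
      exact ⟨fun h => hw.2 (h ▸ hi), .inl (hC.mem_edges _ _ _ hc)⟩
    · simp only [Finset.coe_sdiff, Set.mem_sdiff, Finset.mem_coe, Finset.mem_filter,
        Finset.mem_univ, true_and] at hw hw'
      have hc := hf w hw.1 hw.2
      rw [h] at hc
      exact Fin.ext (hC.unique _ _ _ _ hc (hf w' hw'.1 hw'.2))
  · ext w
    simpa using hT w w.2

theorem ncard_neighbors_le_countP (n : ℕ) (E : Multiset (Sym2 ℕ)) (v : Fin n) :
    {w | (SimpleGraph.fromRel fun a b : Fin n => s((a : ℕ), (b : ℕ)) ∈ E).Adj v w}.ncard ≤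
      E.countP ((v : ℕ) ∈ ·) := by
  calc _ ≤ ((E.filter ((v : ℕ) ∈ ·)).toFinset : Set (Sym2 ℕ)).ncard := by
        refine Set.ncard_le_ncard_of_injOn (fun w : Fin n => s((v : ℕ), (w : ℕ))) ?_ ?_
          (Finset.finite_toSet _)
        · rintro w ⟨-, h | h⟩
          · simpa using h
          · simpa [Sym2.eq_swap] using h
        · intro w _ w' _ h
          exact Fin.ext (Sym2.congr_right.1 h)
    _ ≤ _ := by
        rw [Set.ncard_coe_finset, Multiset.countP_eq_card_filter]
        exact Multiset.toFinset_card_le _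

theorem isSP_fromRel {n sv tv : ℕ} {E : Multiset (Sym2 ℕ)} (hne : sv ≠ tv)
    (h : SPBuildFrom {sv, tv} {s(sv, tv)} (Finset.Ico 0 n) E) :
    IsSP (SimpleGraph.fromRel fun a b : Fin n => s((a : ℕ), (b : ℕ)) ∈ E) :=
  ⟨sv, tv, _, E, hne, h,
    ⟨{ toFun := fun a => ⟨a, by simp⟩
       invFun := fun a => ⟨a, by simpa using a.2⟩
       left_inv := fun _ => rfl
       right_inv := fun _ => rfl
       map_rel_iff' := by simp [underlyingGraph, Fin.ext_iff] }⟩⟩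

/-- For every `n ≥ 5` there exists a simple series-parallel graph on `n`
vertices with maximum degree at most `⌈log₂ n⌉ - 1` and broadcast time at most
`⌊(3 ⌈log₂ n⌉)/2⌋`. -/
theorem exists_SP_small_degree_fast_broadcast (n : ℕ) (hn : 5 ≤ n) :
    ∃ G : SimpleGraph (Fin n), IsSP G ∧
      (∀ v : Fin n, {w | G.Adj v w}.ncard ≤ Nat.clog 2 n - 1) ∧
      broadcastTime G ≤ 3 * Nat.clog 2 n / 2 := by
  have hk : 3 ≤ Nat.clog 2 n := (Nat.lt_clog_iff_pow_lt (by omega)).2 (by omega)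
  obtain ⟨r, r', E, h⟩ := exists_mirroredBinomial (m := Nat.clog 2 n - 1) (by omega)
    (Nat.pow_pred_clog_lt_self (by omega) (by omega)).le
    (by rw [Nat.sub_add_cancel (by omega)]; exact Nat.le_pow_clog (by omega) n) 0
  rw [zero_add] at h
  refine ⟨_, isSP_fromRel h.ne h.spBuildFrom, fun v => ?_, Finset.sup_le fun v _ => ?_⟩
  · exact (ncard_neighbors_le_countP n E v).trans ((h.countP_le v).trans (by omega))
  · obtain ⟨a, a', -, -, -, hp⟩ := h.hasOriginPlans (v := v) (by simp)
    obtain ⟨C, hC⟩ := hp 0 (3 * Nat.clog 2 n / 2) (by omega)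
    exact Nat.sInf_le (exists_broadcastScheme v.2
      (fun u w he => by simpa using (h.mem_of_edge he).1) hC.1
      fun w hw => hC.covers w (by simpa using hw))
end

section
/- Every simple series-parallel graph on at least 3 vertices contains a vertex that has exactly two neighbors. -/
/-- Multigraphs built from a loopless multigraph are loopless, and their edges join vertices. -/
theorem SPBuildFrom.mem_and_ne {V₀ V : Finset ℕ} {E₀ E : Multiset (Sym2 ℕ)}
    (h : SPBuildFrom V₀ E₀ V E)
    (h₀ : ∀ a b, s(a, b) ∈ E₀ → a ∈ V₀ ∧ b ∈ V₀ ∧ a ≠ b) :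
    ∀ a b, s(a, b) ∈ E → a ∈ V ∧ b ∈ V ∧ a ≠ b := by
  induction h with
  | base => exact h₀
  | parallel e he _ ih =>
    intro a b hab
    rcases Multiset.mem_cons.1 hab with rfl | hab
    · exact ih a b he
    · exact ih a b hab
  | @series V E u w x he hx _ ih =>
    obtain ⟨hu, hw, -⟩ := ih u w he
    have hux : u ≠ x := fun h => hx (h ▸ hu)
    have hwx : w ≠ x := fun h => hx (h ▸ hw)
    intro a b hab
    simp only [Multiset.mem_cons, Sym2.eq_iff] at hab
    rcases hab with (⟨rfl, rfl⟩ | ⟨rfl, rfl⟩) | (⟨rfl, rfl⟩ | ⟨rfl, rfl⟩) | hab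
    · simp [hu, hux]
    · simp [hu, hux.symm]
    · simp [hw, hwx.symm]
    · simp [hw, hwx]
    · obtain ⟨ha, hb, hne⟩ := ih a b (Multiset.mem_of_mem_erase hab)
      exact ⟨Finset.mem_insert_of_mem ha, Finset.mem_insert_of_mem hb, hne⟩

/-- Either no series extension was used, or the vertex added by the last one is joined to
exactly two vertices. -/
theorem SPBuildFrom.eq_or_exists_two_neighbors {V₀ V : Finset ℕ} {E₀ E : Multiset (Sym2 ℕ)}
    (h : SPBuildFrom V₀ E₀ V E)
    (h₀ : ∀ a b, s(a, b) ∈ E₀ → a ∈ V₀ ∧ b ∈ V₀ ∧ a ≠ b) :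
    V = V₀ ∨ ∃ x ∈ V, ∃ u w, u ≠ w ∧ ∀ y, s(x, y) ∈ E ↔ y = u ∨ y = w := by
  induction h with
  | base => exact Or.inl rfl
  | parallel e he _ ih =>
    refine ih.imp_right ?_
    rintro ⟨x, hx, u, w, huw, hy⟩
    refine ⟨x, hx, u, w, huw, fun y => ?_⟩
    rw [← hy, Multiset.mem_cons, or_iff_right_of_imp]
    rintro rfl
    exact he
  | @series V E u w x he hx hb _ =>
    have hE := hb.mem_and_ne h₀
    obtain ⟨hu, hw, huw⟩ := hE u w he
    refine Or.inr ⟨x, Finset.mem_insert_self x V, u, w, huw, fun y => ?_⟩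
    have hxy : s(x, y) ∉ E.erase s(u, w) := fun h =>
      hx (hE x y (Multiset.mem_of_mem_erase h)).1
    have hux : x ≠ u := fun h => hx (h ▸ hu)
    have hxw : x ≠ w := fun h => hx (h ▸ hw)
    simp [hxy, hux, hxw]

/-- Every simple series-parallel graph on at least 3 vertices contains a
vertex that has exactly two neighbors. -/
theorem SP_exists_degree_two {V : Type*} [Fintype V] (G : SimpleGraph V)
    (hSP : IsSP G) (hcard : 3 ≤ Fintype.card V) :
    ∃ v : V, {w | G.Adj v w}.ncard = 2 := by
  obtain ⟨s, t, W, E, hst, hb, ⟨φ⟩⟩ := hSP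
  have h₀ : ∀ a b, s(a, b) ∈ ({s(s, t)} : Multiset (Sym2 ℕ)) →
      a ∈ ({s, t} : Finset ℕ) ∧ b ∈ ({s, t} : Finset ℕ) ∧ a ≠ b := by
    intro a b hab
    simp only [Multiset.mem_singleton, Sym2.eq_iff] at hab
    rcases hab with ⟨rfl, rfl⟩ | ⟨rfl, rfl⟩
    · simp [hst]
    · simp [hst.symm]
  have hE := hb.mem_and_ne h₀
  have hW : Fintype.card V = W.card := by
    rw [Fintype.card_congr φ.toEquiv, Fintype.card_coe]
  rcases hb.eq_or_exists_two_neighbors h₀ with rfl | ⟨x, hx, u, w, huw, hy⟩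
  · have := Finset.card_le_two (a := s) (b := t)
    omega
  · have hu := hE x u ((hy u).2 (Or.inl rfl))
    have hw := hE x w ((hy w).2 (Or.inr rfl))
    refine ⟨φ.symm ⟨x, hx⟩, Set.ncard_eq_two.2
      ⟨φ.symm ⟨u, hu.2.1⟩, φ.symm ⟨w, hw.2.1⟩, by simpa using huw, ?_⟩⟩
    ext v
    obtain ⟨⟨y, hyW⟩, rfl⟩ := φ.symm.surjective v
    change G.Adj _ _ ↔ φ.symm _ = φ.symm _ ∨ φ.symm _ = φ.symm _
    have hxy : s(y, x) ∈ E ↔ s(x, y) ∈ E := by rw [Sym2.eq_swap]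
    have hne : (y = u ∨ y = w) → x ≠ y := fun h => (hE x y ((hy y).2 h)).2.2
    rw [φ.symm.map_adj_iff, φ.symm.injective.eq_iff, φ.symm.injective.eq_iff]
    simp only [underlyingGraph, SimpleGraph.fromRel_adj, hxy, hy, or_self, ne_eq,
      Subtype.mk.injEq]
    exact ⟨And.right, fun h => ⟨hne h, h⟩⟩
end

section
/- For every k ≥ 3, there does not exist a simple series-parallel broadcast graph on 2^k vertices; that is, every simple series-parallel graph G on 2^k vertices satisfies b(G) > k = ⌈log₂(2^k)⌉. -/
namespace SPBuildFrom

variable {V₀ V : Finset ℕ} {E₀ E : Multiset (Sym2 ℕ)}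

theorem mem_of_mem_edges (h : SPBuildFrom V₀ E₀ V E)
    (h₀ : ∀ a b, s(a, b) ∈ E₀ → a ∈ V₀) : ∀ a b, s(a, b) ∈ E → a ∈ V := by
  induction h with
  | base => exact h₀
  | parallel e he _ ih =>
    intro a b hab
    rcases Multiset.mem_cons.1 hab with rfl | hab
    · exact ih a b he
    · exact ih a b hab
  | series u w x he hx _ ih =>
    intro a b hab
    have hu := ih u w he
    have hw := ih w u (Sym2.eq_swap ▸ he)
    rcases Multiset.mem_cons.1 hab with hab | hab
    · rcases Sym2.eq_iff.1 hab with ⟨rfl, rfl⟩ | ⟨rfl, rfl⟩ <;> simp [hu]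
    rcases Multiset.mem_cons.1 hab with hab | hab
    · rcases Sym2.eq_iff.1 hab with ⟨rfl, rfl⟩ | ⟨rfl, rfl⟩ <;> simp [hw]
    · exact Finset.mem_insert_of_mem (ih a b (Multiset.mem_of_mem_erase hab))

/-- The vertex added by the last series extension has at most two neighbours. -/
theorem exists_neighbors_subset_pair (h : SPBuildFrom V₀ E₀ V E)
    (h₀ : ∀ a b, s(a, b) ∈ E₀ → a ∈ V₀)
    (hd : ∃ v ∈ V₀, ∃ a ∈ V₀, ∃ b ∈ V₀, ∀ y, s(v, y) ∈ E₀ → y = a ∨ y = b) :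
    ∃ v ∈ V, ∃ a ∈ V, ∃ b ∈ V, ∀ y, s(v, y) ∈ E → y = a ∨ y = b := by
  induction h with
  | base => exact hd
  | parallel e he _ ih =>
    obtain ⟨v, hv, a, ha, b, hb, hab⟩ := ih
    refine ⟨v, hv, a, ha, b, hb, fun y hy => hab y ?_⟩
    rcases Multiset.mem_cons.1 hy with rfl | hy
    · exact he
    · exact hy
  | series u w x he hx h ih =>
    have hmem := h.mem_of_mem_edges h₀
    have hu := hmem u w he
    have hw := hmem w u (Sym2.eq_swap ▸ he)
    refine ⟨x, Finset.mem_insert_self _ _, u, Finset.mem_insert_of_mem hu,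
      w, Finset.mem_insert_of_mem hw, fun y hy => ?_⟩
    rcases Multiset.mem_cons.1 hy with hy | hy
    · rcases Sym2.eq_iff.1 hy with ⟨rfl, rfl⟩ | ⟨_, rfl⟩ <;> simp
    rcases Multiset.mem_cons.1 hy with hy | hy
    · rcases Sym2.eq_iff.1 hy with ⟨_, rfl⟩ | ⟨rfl, rfl⟩ <;> simp
    · exact absurd (hmem x y (Multiset.mem_of_mem_erase hy)) hx

/-- Connectedness, in cut form, is preserved by series and parallel extensions. -/
theorem exists_crossing_edge (h : SPBuildFrom V₀ E₀ V E)
    (h₀ : ∀ a b, s(a, b) ∈ E₀ → a ∈ V₀)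
    (hc : ∀ S : Set ℕ, ∀ a ∈ V₀, a ∈ S → ∀ b ∈ V₀, b ∉ S →
      ∃ p ∈ S, ∃ q ∉ S, s(p, q) ∈ E₀) :
    ∀ S : Set ℕ, ∀ a ∈ V, a ∈ S → ∀ b ∈ V, b ∉ S →
      ∃ p ∈ S, ∃ q ∉ S, s(p, q) ∈ E := by
  induction h with
  | base => exact hc
  | parallel e he _ ih =>
    intro S a ha haS b hb hbS
    obtain ⟨p, hp, q, hq, hpq⟩ := ih S a ha haS b hb hbS
    exact ⟨p, hp, q, hq, Multiset.mem_cons_of_mem hpq⟩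
  | @series V E u w x he hx h ih =>
    intro S a ha haS b hb hbS
    have hu := h.mem_of_mem_edges h₀ u w he
    set E' := s(u, x) ::ₘ s(x, w) ::ₘ E.erase s(u, w)
    have hux : s(u, x) ∈ E' := by simp [E']
    have hxu : s(x, u) ∈ E' := Sym2.eq_swap ▸ hux
    have hxw : s(x, w) ∈ E' := by simp [E']
    have hwx : s(w, x) ∈ E' := Sym2.eq_swap ▸ hxw
    by_cases huS : u ∈ S <;> by_cases hxS : x ∈ S
    · have hbV : b ∈ V := (Finset.mem_insert.1 hb).resolve_left (by rintro rfl; exact hbS hxS)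
      obtain ⟨p, hp, q, hq, hpq⟩ := ih S u hu huS b hbV hbS
      by_cases heq : s(p, q) = s(u, w)
      · rcases Sym2.eq_iff.1 heq with ⟨rfl, rfl⟩ | ⟨rfl, rfl⟩
        · exact ⟨x, hxS, q, hq, hxw⟩
        · exact absurd huS hq
      · exact ⟨p, hp, q, hq, by simp [E', (Multiset.mem_erase_of_ne heq).2 hpq]⟩
    · exact ⟨u, huS, x, hxS, hux⟩
    · exact ⟨x, hxS, u, huS, hxu⟩
    · have haV : a ∈ V := (Finset.mem_insert.1 ha).resolve_left (by rintro rfl; exact hxS haS)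
      obtain ⟨p, hp, q, hq, hpq⟩ := ih S a haV haS u hu huS
      by_cases heq : s(p, q) = s(u, w)
      · rcases Sym2.eq_iff.1 heq with ⟨rfl, rfl⟩ | ⟨rfl, rfl⟩
        · exact absurd hp huS
        · exact ⟨p, hp, x, hxS, hwx⟩
      · exact ⟨p, hp, q, hq, by simp [E', (Multiset.mem_erase_of_ne heq).2 hpq]⟩

end SPBuildFrom

theorem underlyingGraph_adj {V : Finset ℕ} {E : Multiset (Sym2 ℕ)} {a b : {x // x ∈ V}} :
    (underlyingGraph V E).Adj a b ↔ a ≠ b ∧ s((a : ℕ), (b : ℕ)) ∈ E := by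
  rw [underlyingGraph, SimpleGraph.fromRel_adj, Sym2.eq_swap (a := (b : ℕ)), or_self]

theorem mem_of_mem_single_edge {s t : ℕ} (a b : ℕ)
    (h : s(a, b) ∈ ({s(s, t)} : Multiset (Sym2 ℕ))) : a ∈ ({s, t} : Finset ℕ) := by
  rcases Sym2.eq_iff.1 (Multiset.mem_singleton.1 h) with ⟨rfl, rfl⟩ | ⟨rfl, rfl⟩ <;> simp

namespace IsSP

variable {α : Type*} {G : SimpleGraph α}

/-- A series-parallel graph has a vertex with at most two neighbours. -/
theorem exists_neighbors_subset_pair (h : IsSP G) :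
    ∃ v a b, ∀ y, G.Adj v y → y = a ∨ y = b := by
  obtain ⟨s, t, V, E, hst, hB, ⟨e⟩⟩ := h
  obtain ⟨v, hv, a, ha, b, hb, hab⟩ := hB.exists_neighbors_subset_pair mem_of_mem_single_edge
    ⟨s, by simp, t, by simp, t, by simp, fun y hy => by
      rcases Sym2.eq_iff.1 (Multiset.mem_singleton.1 hy) with ⟨_, rfl⟩ | ⟨rfl, rfl⟩ <;> simp⟩
  refine ⟨e.symm ⟨v, hv⟩, e.symm ⟨a, ha⟩, e.symm ⟨b, hb⟩, fun y hy => ?_⟩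
  have hadj := e.map_adj_iff.2 hy
  rw [RelIso.apply_symm_apply, underlyingGraph_adj] at hadj
  refine (hab _ hadj.2).imp (fun h => ?_) (fun h => ?_) <;>
    exact (e.symm_apply_apply y).symm.trans (congrArg e.symm (Subtype.ext h))

/-- A series-parallel graph is connected: every nontrivial cut is crossed by an edge. -/
theorem exists_crossing_adj (h : IsSP G) (S : Set α) (a b : α) (ha : a ∈ S) (hb : b ∉ S) :
    ∃ p ∈ S, ∃ q ∉ S, G.Adj p q := by
  obtain ⟨s, t, V, E, hst, hB, ⟨e⟩⟩ := h
  have hmem := hB.mem_of_mem_edges mem_of_mem_single_edge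
  have himage : ∀ x : {x // x ∈ V},
      (x : ℕ) ∈ (fun c => (e c : ℕ)) '' S ↔ e.symm x ∈ S := by
    intro x
    constructor
    · rintro ⟨c, hc, hcx⟩
      rwa [← Subtype.ext hcx, RelIso.symm_apply_apply]
    · exact fun hx => ⟨_, hx, by simp⟩
  obtain ⟨p, hp, q, hq, hpq⟩ := hB.exists_crossing_edge mem_of_mem_single_edge
    (fun S a ha haS b hb hbS => by
      refine ⟨a, haS, b, hbS, ?_⟩
      simp only [Finset.mem_insert, Finset.mem_singleton] at ha hb
      rw [Multiset.mem_singleton, Sym2.eq_iff]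
      rcases ha with rfl | rfl <;> rcases hb with rfl | rfl <;> simp_all)
    ((fun c => (e c : ℕ)) '' S) (e a) (e a).2 ⟨a, ha, rfl⟩ (e b) (e b).2
    (by rw [himage, RelIso.symm_apply_apply]; exact hb)
  have hpV := hmem p q hpq
  have hqV := hmem q p (Sym2.eq_swap ▸ hpq)
  refine ⟨e.symm ⟨p, hpV⟩, (himage ⟨p, hpV⟩).1 hp, e.symm ⟨q, hqV⟩,
    fun h => hq ((himage ⟨q, hqV⟩).2 h), ?_⟩
  rw [e.symm.map_adj_iff, underlyingGraph_adj]
  exact ⟨fun h => hq (Subtype.mk.inj h ▸ hp), hpq⟩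

end IsSP

namespace IsBroadcastScheme

variable {V : Type*} [DecidableEq V] {G : SimpleGraph V} {v : V} {A : ℕ → Finset V}

theorem subset_succ (h : IsBroadcastScheme G v A) (i : ℕ) : A i ⊆ A (i + 1) := (h.2 i).1

theorem monotone (h : IsBroadcastScheme G v A) : Monotone A :=
  monotone_nat_of_le_succ h.subset_succ

theorem card_succ_le (h : IsBroadcastScheme G v A) (i : ℕ) :
    (A (i + 1)).card ≤ 2 * (A i).card := by
  obtain ⟨hsub, f, hf, hinj⟩ := h.2 i
  have := Finset.card_le_card_of_injOn f (fun w hw => (hf w hw).1) hinj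
  have := Finset.card_sdiff_add_card_eq_card hsub
  omega

theorem card_add_le (h : IsBroadcastScheme G v A) (i j : ℕ) :
    (A (i + j)).card ≤ 2 ^ j * (A i).card := by
  induction j with
  | zero => simp
  | succ j ih =>
    calc (A (i + (j + 1))).card ≤ 2 * (A (i + j)).card := h.card_succ_le (i + j)
      _ ≤ 2 * (2 ^ j * (A i).card) := by gcongr
      _ = 2 ^ (j + 1) * (A i).card := by ring

/-- If the number of informed vertices attains the maximum `2 ^ k` after `k` time units, then
the originator informs a new neighbour in each of these time units. -/
theorem exists_adj_of_card_eq (h : IsBroadcastScheme G v A) {k : ℕ}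
    (hk : (A k).card = 2 ^ k) :
    ∀ i < k, ∃ w ∈ A (i + 1), w ∉ A i ∧ G.Adj v w := by
  have hcard : ∀ i ≤ k, (A i).card = 2 ^ i := by
    intro i hi
    apply le_antisymm
    · simpa [h.1] using h.card_add_le 0 i
    · have := h.card_add_le i (k - i)
      rw [Nat.add_sub_cancel' hi, hk, ← Nat.sub_add_cancel hi, pow_add,
        Nat.sub_add_cancel hi] at this
      exact Nat.le_of_mul_le_mul_left this (by positivity)
  intro i hi
  obtain ⟨hsub, f, hf, hinj⟩ := h.2 i
  have hsdiff := Finset.card_sdiff_add_card_eq_card hsub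
  rw [hcard i hi.le, hcard (i + 1) hi, pow_succ] at hsdiff
  have hv : v ∈ A i := h.monotone (Nat.zero_le i) (by simp [h.1])
  obtain ⟨w, hw, rfl⟩ := Finset.surjOn_of_injOn_of_card_le f (fun w hw => (hf w hw).1) hinj
    (by rw [hcard i hi.le]; omega) hv
  have hw' := Finset.mem_sdiff.1 (Finset.mem_coe.1 hw)
  exact ⟨w, hw'.1, hw'.2, (hf w hw).2⟩

end IsBroadcastScheme

section Existence

variable {V : Type*} [DecidableEq V] [Fintype V] {G : SimpleGraph V}

/-- A broadcast in a connected graph terminates: inform one new vertex at a time. -/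
theorem exists_isBroadcastScheme_eq_univ
    (hG : ∀ (S : Set V) (a b : V), a ∈ S → b ∉ S → ∃ p ∈ S, ∃ q ∉ S, G.Adj p q) (v : V) :
    ∃ T A, IsBroadcastScheme G v A ∧ A T = Finset.univ := by
  have hstep : ∀ S : Finset V, ∃ S' : Finset V, S ⊆ S' ∧ (v ∈ S → S ≠ Finset.univ →
      S.card < S'.card) ∧ ∃ f : V → V, (∀ w ∈ S' \ S, f w ∈ S ∧ G.Adj (f w) w) ∧
      Set.InjOn f ↑(S' \ S) := by
    intro S
    by_cases hS : v ∈ S ∧ S ≠ Finset.univ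
    · obtain ⟨b, hb⟩ : ∃ b, b ∉ S := by simpa [Finset.eq_univ_iff_forall] using hS.2
      obtain ⟨p, hp, q, hq, hpq⟩ := hG ↑S v b hS.1 (by simpa using hb)
      rw [Finset.mem_coe] at hp hq
      have hdiff : insert q S \ S = {q} := by ext x; simp; grind
      refine ⟨insert q S, Finset.subset_insert _ _, fun _ _ => ?_, fun _ => p, ?_, ?_⟩
      · simp [Finset.card_insert_of_notMem hq]
      · simp [hdiff, hp, hpq]
      · simp [hdiff]
    · exact ⟨S, subset_rfl, fun h h' => absurd ⟨h, h'⟩ hS, id, by simp, by simp⟩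
  choose next hsub hlt hinf using hstep
  let A : ℕ → Finset V := fun i => next^[i] {v}
  have hsucc : ∀ i, A (i + 1) = next (A i) := fun i => Function.iterate_succ_apply' _ _ _
  have hA : IsBroadcastScheme G v A :=
    ⟨rfl, fun i => by rw [hsucc]; exact ⟨hsub _, hinf _⟩⟩
  have hgrow : ∀ i, A i = Finset.univ ∨ i < (A i).card := by
    intro i
    induction i with
    | zero => right; simp [A]
    | succ i ih =>
      by_cases hi : A i = Finset.univ
      · exact Or.inl (Finset.univ_subset_iff.1 (hi ▸ hA.subset_succ i))
      · have hv : v ∈ A i := hA.monotone (Nat.zero_le i) (by simp [hA.1])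
        have := hlt _ hv hi
        rw [← hsucc] at this
        exact Or.inr (lt_of_le_of_lt (ih.resolve_left hi) this)
  exact ⟨Fintype.card V, A, hA,
    (hgrow _).resolve_right (Finset.card_le_univ _).not_gt⟩

theorem exists_scheme_of_broadcastTimeFrom_le
    (hG : ∀ (S : Set V) (a b : V), a ∈ S → b ∉ S → ∃ p ∈ S, ∃ q ∉ S, G.Adj p q)
    {v : V} {k : ℕ} (hk : broadcastTimeFrom G v ≤ k) :
    ∃ A, IsBroadcastScheme G v A ∧ A k = Finset.univ := by
  obtain ⟨A, hA, hT⟩ := Nat.sInf_mem (s := {T | ∃ A : ℕ → Finset V,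
    IsBroadcastScheme G v A ∧ A T = Finset.univ}) (exists_isBroadcastScheme_eq_univ hG v)
  exact ⟨A, hA, Finset.univ_subset_iff.1 (hT ▸ hA.monotone hk)⟩

end Existence

/-- For every `k ≥ 3` there is no simple series-parallel broadcast graph
on `2^k` vertices: every simple series-parallel graph `G` on `2^k` vertices satisfies
`b(G) > k = ⌈log₂ (2^k)⌉`. -/
theorem no_SP_broadcast_graph_on_two_pow {V : Type*} [Fintype V] [DecidableEq V]
    (k : ℕ) (hk : 3 ≤ k) (G : SimpleGraph V)
    (hcard : Fintype.card V = 2 ^ k) (hSP : IsSP G) :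
    k < broadcastTime G ∧ Nat.clog 2 (2 ^ k) = k := by
  have hclog : Nat.clog 2 (2 ^ k) = k := Nat.clog_pow 2 k (by norm_num)
  refine ⟨?_, hclog⟩
  by_contra! hle
  obtain ⟨v, a, b, hab⟩ := hSP.exists_neighbors_subset_pair
  obtain ⟨A, hA, hAk⟩ := exists_scheme_of_broadcastTimeFrom_le hSP.exists_crossing_adj
    ((Finset.le_sup (f := fun v => broadcastTimeFrom G v) (Finset.mem_univ v)).trans hle)
  have key := hA.exists_adj_of_card_eq (by rw [hAk, Finset.card_univ, hcard])
  obtain ⟨w₀, h₀, n₀, g₀⟩ := key 0 (by omega)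
  obtain ⟨w₁, h₁, n₁, g₁⟩ := key 1 (by omega)
  obtain ⟨w₂, h₂, n₂, g₂⟩ := key 2 (by omega)
  have h01 : w₀ ≠ w₁ := fun h => n₁ (h ▸ h₀)
  have h12 : w₁ ≠ w₂ := fun h => n₂ (h ▸ h₁)
  have h02 : w₀ ≠ w₂ := fun h => n₂ (h ▸ hA.subset_succ 1 h₀)
  have c₀ := hab _ g₀
  have c₁ := hab _ g₁
  have c₂ := hab _ g₂
  grind
end

section
/- For every n ≥ 2 there exists a simple series-parallel graph on n vertices whose broadcast time is at most ⌈log₂ n⌉ + 1. -/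
/-- The edges of the cone with apex `0` over the tree on `1, …, m + 1` in which every vertex
`w ≥ 2` has parent `p w`. -/
def coneEdges (p : ℕ → ℕ) : ℕ → Multiset (Sym2 ℕ)
  | 0 => {s(0, 1)}
  | m + 1 => s(0, m + 2) ::ₘ s(m + 2, p (m + 2)) ::ₘ coneEdges p m

theorem apex_mem_coneEdges (p : ℕ → ℕ) {m w : ℕ} (h₁ : 1 ≤ w) (h₂ : w ≤ m + 1) :
    s(0, w) ∈ coneEdges p m := by
  induction m with
  | zero =>
    obtain rfl : w = 1 := by omega
    simp [coneEdges]
  | succ m ih =>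
    obtain rfl | h := eq_or_ne w (m + 2)
    · simp [coneEdges]
    · exact Multiset.mem_cons_of_mem (Multiset.mem_cons_of_mem (ih (by omega)))

theorem parent_mem_coneEdges (p : ℕ → ℕ) {m w : ℕ} (h₁ : 2 ≤ w) (h₂ : w ≤ m + 1) :
    s(w, p w) ∈ coneEdges p m := by
  induction m with
  | zero => omega
  | succ m ih =>
    obtain rfl | h := eq_or_ne w (m + 2)
    · simp [coneEdges]
    · exact Multiset.mem_cons_of_mem (Multiset.mem_cons_of_mem (ih (by omega)))

/-- The cone over a tree arises from a single edge by series and parallel extensions. -/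
theorem SPBuildFrom_coneEdges {p : ℕ → ℕ} (hp : ∀ w, 2 ≤ w → 1 ≤ p w ∧ p w < w) (m : ℕ) :
    SPBuildFrom {0, 1} {s(0, 1)} (Finset.range (m + 2)) (coneEdges p m) := by
  induction m with
  | zero => exact SPBuildFrom.base
  | succ m ih =>
    have hmem : s(0, p (m + 2)) ∈ coneEdges p m :=
      apex_mem_coneEdges p (hp _ (by omega)).1 (by have := (hp (m + 2) (by omega)).2; omega)
    have h := SPBuildFrom.series 0 (p (m + 2)) (m + 2) (Multiset.mem_cons_self _ _) (by simp)
      (SPBuildFrom.parallel _ hmem ih)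
    rwa [Multiset.erase_cons_head, ← Finset.range_add_one] at h

theorem broadcastTimeFrom_le {V : Type*} [DecidableEq V] [Fintype V] {G : SimpleGraph V} {v : V}
    {A : ℕ → Finset V} {T : ℕ} (hA : IsBroadcastScheme G v A) (hT : A T = Finset.univ) :
    broadcastTimeFrom G v ≤ T :=
  Nat.sInf_le ⟨A, hA, hT⟩

/-- If the vertex `0` is adjacent to all others and each `j < 2 ^ i` is adjacent to `j + 2 ^ i`,
then any originator can inform `0` first and then run the doubling scheme from `0`. -/
theorem broadcastTime_le_clog_add_one {n : ℕ} (hn : 0 < n) {G : SimpleGraph (Fin n)}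
    (hapex : ∀ v : Fin n, (v : ℕ) ≠ 0 → G.Adj v ⟨0, hn⟩)
    (hdouble : ∀ (i : ℕ) (a b : Fin n), (a : ℕ) < 2 ^ i → (b : ℕ) = a + 2 ^ i → G.Adj a b) :
    broadcastTime G ≤ Nat.clog 2 n + 1 := by
  refine Finset.sup_le fun v _ => ?_
  let A : ℕ → Finset (Fin n)
    | 0 => {v}
    | i + 1 => insert v (Finset.univ.filter fun x : Fin n => (x : ℕ) < 2 ^ i)
  refine broadcastTimeFrom_le (A := A) ⟨rfl, fun i => ?_⟩ ?_
  · cases i with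
    | zero =>
      refine ⟨by simp [A], fun _ => v, fun w hw => ?_, fun a ha b hb _ => ?_⟩
      · simp only [A, pow_zero, Finset.mem_sdiff, Finset.mem_insert, Finset.mem_filter,
          Finset.mem_univ, true_and, Finset.mem_singleton] at hw
        have hw0 : w = ⟨0, hn⟩ := Fin.ext (by simpa using hw.1.resolve_left hw.2)
        refine ⟨by simp [A], hw0 ▸ hapex v fun hv => hw.2 ?_⟩
        exact hw0.trans (Fin.ext hv.symm)
      · simp only [A, pow_zero, Finset.coe_sdiff, Set.mem_sdiff, Finset.mem_coe,
          Finset.mem_insert, Finset.mem_filter, Finset.mem_univ, true_and,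
          Finset.mem_singleton] at ha hb
        have ha' := ha.1.resolve_left ha.2
        have hb' := hb.1.resolve_left hb.2
        exact Fin.ext (by omega)
    | succ i =>
      have hpow : 2 ^ (i + 1) = 2 ^ i + 2 ^ i := by ring
      have hnew : ∀ w ∈ A (i + 1 + 1) \ A (i + 1), 2 ^ i ≤ (w : ℕ) ∧ (w : ℕ) < 2 ^ i + 2 ^ i := by
        intro w hw
        simp only [A, hpow, Finset.mem_sdiff, Finset.mem_insert, Finset.mem_filter,
          Finset.mem_univ, true_and, not_or, not_lt] at hw
        exact ⟨hw.2.2, hw.1.resolve_left hw.2.1⟩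
      refine ⟨fun w hw => ?_, fun w => ⟨w.1 - 2 ^ i, (Nat.sub_le _ _).trans_lt w.2⟩, fun w hw => ?_,
        fun a ha b hb hab => ?_⟩
      · simp only [A, Finset.mem_insert, Finset.mem_filter, Finset.mem_univ, true_and] at hw ⊢
        exact hw.imp_right fun h => by omega
      · have h := hnew w hw
        refine ⟨Finset.mem_insert_of_mem ?_, hdouble i _ _ ?_ ?_⟩
        · simp only [Finset.mem_filter, Finset.mem_univ, true_and]
          omega
        · show (w : ℕ) - 2 ^ i < 2 ^ i
          omega
        · show (w : ℕ) = w - 2 ^ i + 2 ^ i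
          omega
      · have h₁ := hnew a ha
        have h₂ := hnew b hb
        have h₃ : (a : ℕ) - 2 ^ i = b - 2 ^ i := congrArg Fin.val hab
        exact Fin.ext (by omega)
  · refine Finset.eq_univ_of_forall fun x => Finset.mem_insert_of_mem ?_
    simpa using x.2.trans_le (Nat.le_pow_clog one_lt_two n)

/-- Clear the leading binary digit of `w`, but send powers of two to `1`. -/
def binomialParent (w : ℕ) : ℕ := max 1 (w - 2 ^ Nat.log 2 w)

theorem binomialParent_bounds (w : ℕ) (hw : 2 ≤ w) :
    1 ≤ binomialParent w ∧ binomialParent w < w := by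
  have := Nat.two_pow_pos (Nat.log 2 w)
  unfold binomialParent
  omega

theorem binomialParent_add_two_pow {i j : ℕ} (h₁ : 1 ≤ j) (h₂ : j < 2 ^ i) :
    binomialParent (j + 2 ^ i) = j := by
  have hlog : Nat.log 2 (j + 2 ^ i) = i :=
    Nat.log_eq_of_pow_le_of_lt_pow (by omega) (by rw [pow_succ]; omega)
  rw [binomialParent, hlog]
  omega

/-- For every `n ≥ 2` there exists a simple series-parallel graph on `n`
vertices whose broadcast time is at most `⌈log₂ n⌉ + 1`. -/
theorem exists_SP_broadcast_le_clog_add_one (n : ℕ) (hn : 2 ≤ n) :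
    ∃ G : SimpleGraph (Fin n), IsSP G ∧ broadcastTime G ≤ Nat.clog 2 n + 1 := by
  obtain ⟨m, rfl⟩ := Nat.exists_eq_add_of_le' hn
  let e : Fin (m + 2) ≃ {x // x ∈ Finset.range (m + 2)} :=
    Fin.equivSubtype.trans (Equiv.subtypeEquivRight fun x => Finset.mem_range.symm)
  let G := (underlyingGraph (Finset.range (m + 2)) (coneEdges binomialParent m)).comap e
  have hadj (a b : Fin (m + 2)) : G.Adj a b ↔ a ≠ b ∧
      (s((a : ℕ), (b : ℕ)) ∈ coneEdges binomialParent m ∨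
        s((b : ℕ), (a : ℕ)) ∈ coneEdges binomialParent m) := by
    rw [← e.injective.ne_iff]
    exact Iff.rfl
  refine ⟨G, ⟨0, 1, _, _, zero_ne_one, SPBuildFrom_coneEdges binomialParent_bounds m,
    ⟨SimpleGraph.Iso.comap e _⟩⟩, broadcastTime_le_clog_add_one (by omega) ?_ ?_⟩
  · intro v hv
    refine (hadj _ _).2 ⟨fun h => hv (congrArg Fin.val h), Or.inr ?_⟩
    exact apex_mem_coneEdges _ (by omega) (by omega)
  · intro i a b ha hb
    have hne : a ≠ b := fun h => by rw [h] at hb; have := Nat.two_pow_pos i; omega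
    refine (hadj _ _).2 ⟨hne, ?_⟩
    obtain h0 | h0 := Nat.eq_zero_or_pos (a : ℕ)
    · rw [h0] at hb ⊢
      exact Or.inl (apex_mem_coneEdges _ (by have := Nat.two_pow_pos i; omega) (by omega))
    · have h := parent_mem_coneEdges binomialParent (m := m) (w := b) (by omega) (by omega)
      rw [hb, binomialParent_add_two_pow h0 ha] at h
      exact Or.inr (hb ▸ h)
end

section
/- For every k ≥ 0, the Binomial SP graph B_k on 2^k + 1 vertices is a simple series-parallel graph with terminals s and t. -/
/-- The Binomial SP graph `B k` on `2^k + 1` vertices: a binomial tree `BT k` rooted at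
`s = some 0` (vertex `some j`, `j ≠ 0`, is joined to its parent obtained by clearing the
highest set bit of `j`), together with an additional vertex `t = none` adjacent to all
`2^k` tree vertices. -/
def Bgraph (k : ℕ) : SimpleGraph (Option (Fin (2 ^ k))) :=
  SimpleGraph.fromRel fun a b =>
    match a, b with
    | some i, some j => (j : ℕ) ≠ 0 ∧ (i : ℕ) = btParent (j : ℕ)
    | none, some _ => True
    | _, _ => False

/-- Doubling an edge `{u, w}` and subdividing the new copy attaches a new vertex to both ends
of the edge. -/
theorem SPBuildFrom.attach {V₀ V : Finset ℕ} {E₀ E : Multiset (Sym2 ℕ)}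
    (h : SPBuildFrom V₀ E₀ V E) {u w x : ℕ} (he : s(u, w) ∈ E) (hx : x ∉ V) :
    SPBuildFrom V₀ E₀ (insert x V) (s(u, x) ::ₘ s(x, w) ::ₘ E) := by
  simpa using SPBuildFrom.series u w x (Multiset.mem_cons_self _ _) hx (h.parallel _ he)

/-- The cone with apex `0` over the recursive tree on `0, …, n` with parent function `p`, where
the tree vertex `j` is encoded as `j + 1`, is built from the edge joining the root to the apex. -/
theorem exists_spBuildFrom_cone (p : ℕ → ℕ) (hp : ∀ j, j ≠ 0 → p j < j) (n : ℕ) :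
    ∃ E, SPBuildFrom {1, 0} {s(1, 0)} (Finset.range (n + 2)) E ∧
      ∀ e, e ∈ E ↔ (∃ j ≤ n, e = s(j + 1, 0)) ∨
        ∃ j ≤ n, j ≠ 0 ∧ e = s(p j + 1, j + 1) := by
  induction n with
  | zero =>
    have hV : Finset.range (0 + 2) = {1, 0} := by decide
    refine ⟨{s(1, 0)}, hV ▸ .base, fun e => ?_⟩
    simp +contextual
  | succ n ih =>
    obtain ⟨E, hE, hmem⟩ := ih
    have hpn := hp (n + 1) n.succ_ne_zero
    refine ⟨s(p (n + 1) + 1, n + 2) ::ₘ s(n + 2, 0) ::ₘ E, ?_, fun e => ?_⟩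
    · rw [Finset.range_add_one]
      exact hE.attach ((hmem _).2 (.inl ⟨p (n + 1), by omega, rfl⟩)) (by simp)
    · simp only [Multiset.mem_cons, hmem, Nat.le_succ_iff, or_and_right, exists_or,
        exists_eq_left]
      simp only [Nat.succ_eq_add_one, ne_eq, Nat.add_eq_zero_iff, one_ne_zero, and_false,
        not_false_eq_true, true_and, Nat.add_assoc, Nat.reduceAdd]
      generalize (∃ j ≤ n, e = s(j + 1, 0)) = q, (∃ j ≤ n, ¬j = 0 ∧ e = s(p j + 1, j + 1)) = r
      tauto

/-- For every `k ≥ 0`, the Binomial SP graph `B k` on `2^k + 1` vertices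
is a simple series-parallel graph with terminals `s = some 0` and `t = none`. -/
theorem Bgraph_isSP (k : ℕ) :
    IsSPWithTerminals (Bgraph k) (some ⟨0, by positivity⟩) none := by
  obtain ⟨E, hE, hmem⟩ := exists_spBuildFrom_cone btParent (fun _ => btParent_lt) (2 ^ k - 1)
  have hk : 0 < 2 ^ k := by positivity
  let f : Option (Fin (2 ^ k)) → {x // x ∈ Finset.range (2 ^ k - 1 + 2)} := fun a =>
    a.elim ⟨0, by simp⟩ fun i => ⟨i + 1, by have := i.2; simp; omega⟩
  have hf : Function.Bijective f := by
    constructor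
    · rintro (_ | i) (_ | j) h <;> simp [f] at h ⊢; exact Fin.ext h
    · rintro ⟨_ | x, hx⟩
      · exact ⟨none, rfl⟩
      · have := Finset.mem_range.1 hx
        exact ⟨some ⟨x, by omega⟩, rfl⟩
  refine ⟨1, 0, _, E, one_ne_zero, hE, ⟨Equiv.ofBijective f hf, fun {a b} => ?_⟩, rfl, rfl⟩
  simp only [underlyingGraph, Bgraph, SimpleGraph.fromRel_adj, Equiv.ofBijective_apply,
    hf.1.ne_iff, hmem]
  refine and_congr_right fun hab => ?_
  rcases a with _ | i <;> rcases b with _ | j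
  · exact absurd rfl hab
  · have := j.2
    simp [f]
    omega
  · have := i.2
    simp [f]
    omega
  · have hi := i.2
    have hj := j.2
    simp [f]
    grind
end

section
/- For every k ≥ 2, the Extended-Binomial SP graph EB_k on n = 2^{k-1} + 2^{⌊k/2⌋} vertices has broadcast time b(EB_k) = ⌈log₂ n⌉ = k, i.e., EB_k is a broadcast graph. -/
/-- The vertex set of the Extended-Binomial SP graph `EB k`: `none` is the terminal `t`;
`some (Sum.inl ·)` are the tree vertices of `B (k-1)` (with `some (Sum.inl 0)` the
terminal `s`); `some (Sum.inr ·)` are the non-root tree vertices of `B (k/2)`. -/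
abbrev EBVertex (k : ℕ) :=
  Option (Fin (2 ^ (k - 1)) ⊕ {j : Fin (2 ^ (k / 2)) // (j : ℕ) ≠ 0})

/-- The Extended-Binomial SP graph `EB k` on `2^(k-1) + 2^(k/2)` vertices: the parallel
composition of `B (k-1)` and `B (k/2)`, identifying their `s`-terminals (the roots of the
two binomial trees, giving `s = some (Sum.inl 0)`) and their `t`-terminals
(`t = none`, adjacent to every other vertex). -/
def EB (k : ℕ) : SimpleGraph (EBVertex k) :=
  SimpleGraph.fromRel fun a b =>
    match a, b with
    | some (Sum.inl i), some (Sum.inl j) => (j : ℕ) ≠ 0 ∧ (i : ℕ) = btParent (j : ℕ)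
    | some (Sum.inl i), some (Sum.inr j) => (i : ℕ) = 0 ∧ btParent (j.1 : ℕ) = 0
    | some (Sum.inr i), some (Sum.inr j) => (i.1 : ℕ) = btParent (j.1 : ℕ)
    | none, some _ => True
    | _, _ => False

section Scheme

variable {V : Type*} [DecidableEq V]

open Classical in
/-- The set of vertices informed after `i` time units when, during time unit `i + 1`, every
informed vertex `u` calls `call i u`; calls along non-edges are ignored. -/
noncomputable def informedSet (G : SimpleGraph V) (call : ℕ → V → V) (v : V) : ℕ → Finset V
  | 0 => {v}
  | i + 1 => informedSet G call v i ∪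
      ((informedSet G call v i).filter fun u => G.Adj u (call i u)).image (call i)

theorem informedSet_mono_succ (G : SimpleGraph V) (call : ℕ → V → V) (v : V) (i : ℕ) :
    informedSet G call v i ⊆ informedSet G call v (i + 1) := by
  rw [informedSet]
  exact Finset.subset_union_left

theorem informedSet_mono (G : SimpleGraph V) (call : ℕ → V → V) (v : V) :
    Monotone (informedSet G call v) :=
  monotone_nat_of_le_succ (informedSet_mono_succ G call v)

theorem mem_informedSet_succ_of_call {G : SimpleGraph V} {call : ℕ → V → V} {v u w : V} {i : ℕ}
    (hu : u ∈ informedSet G call v i) (hcall : call i u = w) (hadj : G.Adj u w) :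
    w ∈ informedSet G call v (i + 1) := by
  subst hcall
  classical
  rw [informedSet]
  exact Finset.mem_union_right _ (Finset.mem_image_of_mem _ (Finset.mem_filter.mpr ⟨hu, hadj⟩))

theorem isBroadcastScheme_informedSet (G : SimpleGraph V) (call : ℕ → V → V) (v : V) :
    IsBroadcastScheme G v (informedSet G call v) := by
  classical
  refine ⟨rfl, fun i => ⟨informedSet_mono_succ G call v i, ?_⟩⟩
  have hcaller : ∀ w : V, ∃ u, w ∈ informedSet G call v (i + 1) \ informedSet G call v i →
      (u ∈ informedSet G call v i ∧ G.Adj u w) ∧ call i u = w := by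
    intro w
    by_cases hw : w ∈ informedSet G call v (i + 1) \ informedSet G call v i
    · rw [Finset.mem_sdiff, informedSet, Finset.mem_union] at hw
      obtain ⟨u, hu, rfl⟩ := Finset.mem_image.mp (hw.1.resolve_left hw.2)
      exact ⟨u, fun _ => ⟨Finset.mem_filter.mp hu, rfl⟩⟩
    · exact ⟨w, fun h => absurd h hw⟩
  choose f hf using hcaller
  refine ⟨f, fun w hw => (hf w hw).1, fun a ha b hb hab => ?_⟩
  rw [← (hf a ha).2, ← (hf b hb).2, hab]

theorem IsBroadcastScheme.card_le {G : SimpleGraph V} {v : V} {A : ℕ → Finset V}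
    (hA : IsBroadcastScheme G v A) (i : ℕ) : (A i).card ≤ 2 ^ i := by
  induction i with
  | zero => simp [hA.1]
  | succ i ih =>
    obtain ⟨hsub, f, hf, hinj⟩ := hA.2 i
    have hnew : (A (i + 1) \ A i).card ≤ (A i).card :=
      Finset.card_le_card_of_injOn f (fun w hw => (hf w hw).1) hinj
    have := Finset.card_sdiff_add_card_eq_card hsub
    rw [pow_succ]
    omega

theorem broadcastTimeFrom_eq [Fintype V] {G : SimpleGraph V} {v : V} {k : ℕ}
    {call : ℕ → V → V} (hall : ∀ w, w ∈ informedSet G call v k)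
    (hcard : Nat.clog 2 (Fintype.card V) = k) : broadcastTimeFrom G v = k := by
  have hmem : k ∈ {T | ∃ A : ℕ → Finset V, IsBroadcastScheme G v A ∧ A T = Finset.univ} :=
    ⟨_, isBroadcastScheme_informedSet G call v, Finset.eq_univ_of_forall hall⟩
  refine le_antisymm (Nat.sInf_le hmem) (le_csInf ⟨k, hmem⟩ ?_)
  rintro T ⟨A, hA, hT⟩
  rw [← hcard, Nat.clog_le_iff_le_pow one_lt_two, ← Finset.card_univ, ← hT]
  exact hA.card_le T

end Scheme

theorem btParent_add_two_pow {w c : ℕ} (hw : w < 2 ^ c) : btParent (w + 2 ^ c) = w := by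
  have hlog : Nat.log 2 (w + 2 ^ c) = c :=
    Nat.log_eq_of_pow_le_of_lt_pow (by omega) (by rw [pow_succ]; omega)
  simp [btParent, hlog]

/-- Adding `2 ^ c` modulo `2 ^ (c + 1)` flips the bit of weight `2 ^ c`. -/
theorem mod_two_pow_succ_cases (x c : ℕ) :
    (x % 2 ^ (c + 1) = x % 2 ^ c ∧ (x + 2 ^ c) % 2 ^ (c + 1) = x % 2 ^ c + 2 ^ c) ∨
      (x % 2 ^ (c + 1) = x % 2 ^ c + 2 ^ c ∧ (x + 2 ^ c) % 2 ^ (c + 1) = x % 2 ^ c) := by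
  have hlt : x % 2 ^ c < 2 ^ c := Nat.mod_lt _ (by positivity)
  have hpow : 2 ^ (c + 1) = 2 ^ c + 2 ^ c := by rw [pow_succ]; omega
  have hmod := Nat.mod_pow_succ (x := x) (b := 2) (k := c)
  have hadd : (x + 2 ^ c) % 2 ^ (c + 1) = (x % 2 ^ (c + 1) + 2 ^ c) % 2 ^ (c + 1) := by
    rw [Nat.mod_add_mod]
  rcases Nat.mod_two_eq_zero_or_one (x / 2 ^ c) with hbit | hbit <;> rw [hbit] at hmod
  · left
    rw [mul_zero, add_zero] at hmod
    exact ⟨hmod, by rw [hadd, hmod, Nat.mod_eq_of_lt (by omega)]⟩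
  · right
    rw [mul_one] at hmod
    refine ⟨hmod, ?_⟩
    rw [hadd, hmod, add_assoc, ← hpow, Nat.add_mod_right, Nat.mod_eq_of_lt (by omega)]

/-- The vertex labelled `w` in the tree of `B (k - 1)`, with junk value `t`. -/
def bigVertex (k w : ℕ) : EBVertex k :=
  if h : w < 2 ^ (k - 1) then some (Sum.inl ⟨w, h⟩) else none

/-- The vertex labelled `w` in the tree of `B (k / 2)`, with junk value `t`. -/
def smallVertex (k w : ℕ) : EBVertex k :=
  if h : w < 2 ^ (k / 2) then
    if h0 : w = 0 then bigVertex k 0 else some (Sum.inr ⟨⟨w, h⟩, h0⟩)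
  else none

theorem bigVertex_of_lt {k w : ℕ} (h : w < 2 ^ (k - 1)) :
    bigVertex k w = some (Sum.inl ⟨w, h⟩) := dif_pos h

theorem smallVertex_zero (k : ℕ) : smallVertex k 0 = bigVertex k 0 := by
  simp [smallVertex]

theorem smallVertex_of_lt {k w : ℕ} (h : w < 2 ^ (k / 2)) (h0 : w ≠ 0) :
    smallVertex k w = some (Sum.inr ⟨⟨w, h⟩, h0⟩) := by
  simp [smallVertex, h, h0]

theorem EB_adj_none_some {k : ℕ} (a : Fin (2 ^ (k - 1)) ⊕ {j : Fin (2 ^ (k / 2)) // (j : ℕ) ≠ 0}) :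
    (EB k).Adj none (some a) := by
  simp [EB]

theorem EB_adj_none_bigVertex {k w : ℕ} (h : w < 2 ^ (k - 1)) :
    (EB k).Adj none (bigVertex k w) := by
  rw [bigVertex_of_lt h]
  exact EB_adj_none_some _

theorem EB_adj_none_smallVertex {k w : ℕ} (h : w < 2 ^ (k / 2)) :
    (EB k).Adj none (smallVertex k w) := by
  by_cases h0 : w = 0
  · rw [h0, smallVertex_zero]
    exact EB_adj_none_bigVertex (by positivity)
  · rw [smallVertex_of_lt h h0]
    exact EB_adj_none_some _

theorem EB_adj_bigVertex {k w c : ℕ} (hw : w < 2 ^ c) (h : w + 2 ^ c < 2 ^ (k - 1)) :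
    (EB k).Adj (bigVertex k w) (bigVertex k (w + 2 ^ c)) := by
  rw [bigVertex_of_lt h, bigVertex_of_lt (by omega)]
  have : 0 < 2 ^ c := by positivity
  simp [EB, btParent_add_two_pow hw]

theorem EB_adj_smallVertex {k w c : ℕ} (hw : w < 2 ^ c) (h : w + 2 ^ c < 2 ^ (k / 2)) :
    (EB k).Adj (smallVertex k w) (smallVertex k (w + 2 ^ c)) := by
  have : 0 < 2 ^ c := by positivity
  rw [smallVertex_of_lt h (by omega)]
  have hparent := btParent_add_two_pow hw
  by_cases h0 : w = 0
  · subst h0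
    rw [smallVertex_zero, bigVertex_of_lt (by positivity)]
    simpa [EB] using hparent
  · rw [smallVertex_of_lt (by omega) h0]
    simp [EB, hparent]

theorem EBVertex.induction {k : ℕ} {P : EBVertex k → Prop} (hnone : P none)
    (hbig : ∀ w < 2 ^ (k - 1), P (bigVertex k w))
    (hsmall : ∀ w < 2 ^ (k / 2), w ≠ 0 → P (smallVertex k w)) (a : EBVertex k) : P a := by
  rcases a with _ | ⟨w, hw⟩ | ⟨⟨w, hw⟩, h0⟩
  · exact hnone
  · exact bigVertex_of_lt hw ▸ hbig w hw
  · exact smallVertex_of_lt hw h0 ▸ hsmall w hw h0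

/-- The calls made after the first time unit when the originator is the vertex `x` of the larger
tree, or is `t` (with `x = 0`).  First `t` informs the roots of the maximal binomial subtrees
avoiding `x`, of order at least `k / 2`, while the originator's message climbs towards `s`;
afterwards `t` acts as the root of the smaller tree. -/
def bigCall (k x i : ℕ) : EBVertex k → EBVertex k
  | none =>
    if i ≤ k - 1 - k / 2 then bigVertex k ((x + 2 ^ (i - 1)) % 2 ^ i)
    else smallVertex k (2 ^ (i - (k - 1 - k / 2) - 1))
  | some (Sum.inl w) =>
    if i ≤ k - 1 - k / 2 + 1 ∧ 2 ^ (k - 1 - k / 2) ≤ (w : ℕ) then bigVertex k (btParent w)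
    else bigVertex k (w + 2 ^ (i - 1))
  | some (Sum.inr w) => smallVertex k ((w.1 : ℕ) + 2 ^ (i - (k - 1 - k / 2) - 1))

/-- The calls made after the first time unit when the originator is a non-root vertex of the
smaller tree: `t` acts as the root of the larger tree, while the originator's message climbs
to the top of the smaller tree and then spreads in it. -/
def smallCall (k i : ℕ) : EBVertex k → EBVertex k
  | none => bigVertex k (2 ^ (i - 1))
  | some (Sum.inl w) =>
    if (w : ℕ) = 0 then smallVertex k (2 ^ (i - (k - 1 - k / 2) - 1))
    else bigVertex k (w + 2 ^ (i - 1))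
  | some (Sum.inr w) =>
    if i ≤ k - 1 - k / 2 + 1 then smallVertex k (btParent w.1)
    else smallVertex k ((w.1 : ℕ) + 2 ^ (i - (k - 1 - k / 2) - 1))

/-- During the first time unit `t` calls `s` and every other vertex calls `t`. -/
def firstCall (k : ℕ) : EBVertex k → EBVertex k
  | none => bigVertex k 0
  | some _ => none

/-- Calls as prescribed by `firstCall` in the first time unit and by `call` afterwards. -/
def startWith (k : ℕ) (call : ℕ → EBVertex k → EBVertex k) : ℕ → EBVertex k → EBVertex k
  | 0 => firstCall k
  | i + 1 => call (i + 1)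

theorem none_mem_informedSet_one {k : ℕ} (call : ℕ → EBVertex k → EBVertex k) (v : EBVertex k) :
    none ∈ informedSet (EB k) (startWith k call) v 1 := by
  rcases v with _ | a
  · exact informedSet_mono_succ _ _ _ 0 (Finset.mem_singleton_self _)
  · exact mem_informedSet_succ_of_call (Finset.mem_singleton_self _) rfl (EB_adj_none_some a).symm

theorem bigVertex_zero_mem_informedSet_one {k : ℕ} (call : ℕ → EBVertex k → EBVertex k) :
    bigVertex k 0 ∈ informedSet (EB k) (startWith k call) none 1 :=
  mem_informedSet_succ_of_call (Finset.mem_singleton_self _) rfl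
    (EB_adj_none_bigVertex (by positivity))

theorem none_mem_informedSet {k : ℕ} {v : EBVertex k}
    (call : ℕ → EBVertex k → EBVertex k) (i : ℕ) :
    none ∈ informedSet (EB k) (startWith k call) v (i + 1) :=
  informedSet_mono _ _ _ (by omega) (none_mem_informedSet_one call v)

section BigOriginator

variable {k x : ℕ} {v : EBVertex k}

theorem informedSet_bigCall_climb (hk : 2 ≤ k) (hx : x < 2 ^ (k - 1))
    (hv : bigVertex k x ∈ informedSet (EB k) (startWith k (bigCall k x)) v 1) (i : ℕ)
    (hi : i + 1 ≤ k / 2) :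
    bigVertex k (x % 2 ^ (k - 1 - i)) ∈
      informedSet (EB k) (startWith k (bigCall k x)) v (i + 1) := by
  induction i with
  | zero => simpa [Nat.mod_eq_of_lt hx] using hv
  | succ i ih =>
    have hinf := ih (by omega)
    obtain ⟨c, hc⟩ : ∃ c, k - 1 - i = c + 1 := ⟨k - 1 - i - 1, by omega⟩
    rw [hc] at hinf
    rw [show k - 1 - (i + 1) = c by omega]
    rcases mod_two_pow_succ_cases x c with ⟨h, -⟩ | ⟨h, -⟩ <;> rw [h] at hinf
    · exact informedSet_mono_succ _ _ _ _ hinf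
    · have hlt : x % 2 ^ c < 2 ^ c := Nat.mod_lt _ (by positivity)
      have hle : x % 2 ^ c + 2 ^ c < 2 ^ (k - 1) := h ▸ (Nat.mod_le _ _).trans_lt hx
      have hg : 2 ^ (k - 1 - k / 2) ≤ 2 ^ c := Nat.pow_le_pow_right (by norm_num) (by omega)
      refine mem_informedSet_succ_of_call hinf ?_ (EB_adj_bigVertex hlt hle).symm
      rw [bigVertex_of_lt hle]
      simp only [startWith, bigCall]
      rw [if_pos ⟨by omega, by omega⟩, btParent_add_two_pow hlt]

theorem bigCall_bigVertex_of_lt {w i : ℕ} (hw : w < 2 ^ (k - 1))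
    (h : i ≤ k - 1 - k / 2 → w < 2 ^ (k - 1 - k / 2)) :
    startWith k (bigCall k x) (i + 1) (bigVertex k w) = bigVertex k (w + 2 ^ i) := by
  rw [bigVertex_of_lt hw]
  simp only [startWith, bigCall]
  rw [if_neg (by rintro ⟨h1, h2⟩; have := h (by omega); omega)]
  rfl

theorem informedSet_bigCall_avoiding (c : ℕ)
    (hc : c ≤ k - 1 - k / 2) (w : ℕ) (hw : w < 2 ^ c) (hwx : w ≠ x % 2 ^ c) :
    bigVertex k w ∈ informedSet (EB k) (startWith k (bigCall k x)) v (c + 1) := by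
  induction c generalizing w with
  | zero => simp [Nat.mod_one] at hw hwx; omega
  | succ c ih =>
    have hpow : 2 ^ (c + 1) = 2 ^ c + 2 ^ c := by rw [pow_succ]; omega
    have hbig : 2 ^ (c + 1) ≤ 2 ^ (k - 1) := Nat.pow_le_pow_right (by norm_num) (by omega)
    have hg : 2 ^ (c + 1) ≤ 2 ^ (k - 1 - k / 2) := Nat.pow_le_pow_right (by norm_num) hc
    by_cases hflip : w = (x + 2 ^ c) % 2 ^ (c + 1)
    · refine mem_informedSet_succ_of_call (none_mem_informedSet _ c) ?_
        (EB_adj_none_bigVertex (by omega))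
      simp only [startWith, bigCall]
      rw [if_pos hc, hflip]
      rfl
    · by_cases hlow : w < 2 ^ c
      · exact informedSet_mono_succ _ _ _ _ (ih (by omega) w hlow (by
          rcases mod_two_pow_succ_cases x c with h | h <;> omega))
      · obtain ⟨u, rfl⟩ : ∃ u, w = u + 2 ^ c := ⟨w - 2 ^ c, by omega⟩
        refine mem_informedSet_succ_of_call (ih (by omega) u (by omega) (by
          rcases mod_two_pow_succ_cases x c with h | h <;> omega)) ?_
          (EB_adj_bigVertex (by omega) (by omega))
        exact bigCall_bigVertex_of_lt (by omega) (by omega)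

theorem informedSet_bigCall_big (hk : 2 ≤ k) (hx : x < 2 ^ (k - 1))
    (hv : bigVertex k x ∈ informedSet (EB k) (startWith k (bigCall k x)) v 1) (c : ℕ)
    (hgc : k - 1 - k / 2 < c) (hck : c < k) (w : ℕ) (hw : w < 2 ^ c) :
    bigVertex k w ∈ informedSet (EB k) (startWith k (bigCall k x)) v (c + 1) := by
  induction c, hgc using Nat.le_induction generalizing w with
  | base =>
    obtain ⟨g, hg⟩ : ∃ g, k - 1 - k / 2 = g := ⟨_, rfl⟩
    rw [hg] at hw ⊢
    rw [Nat.succ_eq_add_one] at hw ⊢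
    have havoid : ∀ u < 2 ^ g, u ≠ x % 2 ^ g →
        bigVertex k u ∈ informedSet (EB k) (startWith k (bigCall k x)) v (g + 1) :=
      informedSet_bigCall_avoiding g hg.ge
    have hclimb : bigVertex k (x % 2 ^ (g + 1)) ∈
        informedSet (EB k) (startWith k (bigCall k x)) v (g + 1) := by
      have := informedSet_bigCall_climb hk hx hv (k / 2 - 1) (by omega)
      rw [show k - 1 - (k / 2 - 1) = g + 1 by omega] at this
      exact informedSet_mono _ _ _ (by omega) this
    have hlt : x % 2 ^ g < 2 ^ g := Nat.mod_lt _ (by positivity)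
    have hpow : 2 ^ (g + 1) = 2 ^ g + 2 ^ g := by rw [pow_succ]; omega
    have hbig : 2 ^ (g + 1) ≤ 2 ^ (k - 1) := Nat.pow_le_pow_right (by norm_num) (by omega)
    have hdown : ∀ u < 2 ^ g,
        bigVertex k u ∈ informedSet (EB k) (startWith k (bigCall k x)) v (g + 1) →
        bigVertex k (u + 2 ^ g) ∈
          informedSet (EB k) (startWith k (bigCall k x)) v (g + 1 + 1) := fun u hu hinf =>
      mem_informedSet_succ_of_call hinf
        (bigCall_bigVertex_of_lt (by omega) fun _ => by rwa [hg])
        (EB_adj_bigVertex hu (by omega))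
    by_cases hlow : w < 2 ^ g
    · by_cases hwx : w = x % 2 ^ g
      · subst hwx
        rcases mod_two_pow_succ_cases x g with ⟨h, -⟩ | ⟨h, -⟩ <;> rw [h] at hclimb
        · exact informedSet_mono_succ _ _ _ _ hclimb
        · have hle : x % 2 ^ g + 2 ^ g < 2 ^ (k - 1) := by omega
          refine mem_informedSet_succ_of_call hclimb ?_ (EB_adj_bigVertex hlt hle).symm
          rw [bigVertex_of_lt hle]
          simp only [startWith, bigCall]
          rw [hg, if_pos ⟨by omega, by omega⟩, btParent_add_two_pow hlt]
      · exact informedSet_mono_succ _ _ _ _ (havoid w hlow hwx)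
    · obtain ⟨u, rfl⟩ : ∃ u, w = u + 2 ^ g := ⟨w - 2 ^ g, by omega⟩
      by_cases hux : u = x % 2 ^ g
      · subst hux
        rcases mod_two_pow_succ_cases x g with ⟨h, -⟩ | ⟨h, -⟩ <;> rw [h] at hclimb
        · exact hdown _ hlt hclimb
        · exact informedSet_mono_succ _ _ _ _ hclimb
      · exact hdown u (by omega) (havoid u (by omega) hux)
  | succ c hgc ih =>
    have hpow : 2 ^ (c + 1) = 2 ^ c + 2 ^ c := by rw [pow_succ]; omega
    have hbig : 2 ^ (c + 1) ≤ 2 ^ (k - 1) := Nat.pow_le_pow_right (by norm_num) (by omega)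
    by_cases hlow : w < 2 ^ c
    · exact informedSet_mono_succ _ _ _ _ (ih (by omega) w hlow)
    · obtain ⟨u, rfl⟩ : ∃ u, w = u + 2 ^ c := ⟨w - 2 ^ c, by omega⟩
      exact mem_informedSet_succ_of_call (ih (by omega) u (by omega))
        (bigCall_bigVertex_of_lt (by omega) (by omega))
        (EB_adj_bigVertex (by omega) (by omega))

theorem informedSet_bigCall_small (j : ℕ) (hj : j ≤ k / 2) (w : ℕ)
    (hw : w < 2 ^ j) (h0 : w ≠ 0) :
    smallVertex k w ∈ informedSet (EB k) (startWith k (bigCall k x)) v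
      (k - 1 - k / 2 + j + 1) := by
  induction j generalizing w with
  | zero => simp at hw; omega
  | succ j ih =>
    have hpow : 2 ^ (j + 1) = 2 ^ j + 2 ^ j := by rw [pow_succ]; omega
    have hsmall : 2 ^ (j + 1) ≤ 2 ^ (k / 2) := Nat.pow_le_pow_right (by norm_num) hj
    have hexp : k - 1 - k / 2 + j + 1 - (k - 1 - k / 2) - 1 = j := by omega
    rw [← add_assoc (k - 1 - k / 2) j 1]
    by_cases hlow : w < 2 ^ j
    · exact informedSet_mono_succ _ _ _ _ (ih (by omega) w hlow h0)
    · obtain ⟨u, rfl⟩ : ∃ u, w = u + 2 ^ j := ⟨w - 2 ^ j, by omega⟩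
      by_cases hu : u = 0
      · subst hu
        refine mem_informedSet_succ_of_call (none_mem_informedSet _ _) ?_
          (EB_adj_none_smallVertex (by omega))
        simp only [startWith, bigCall]
        rw [if_neg (by omega), hexp, zero_add]
      · refine mem_informedSet_succ_of_call (ih (by omega) u (by omega) hu) ?_
          (EB_adj_smallVertex (by omega) (by omega))
        rw [smallVertex_of_lt (by omega) hu]
        simp only [startWith, bigCall]
        rw [hexp]

theorem mem_informedSet_bigCall (hk : 2 ≤ k) (hx : x < 2 ^ (k - 1))
    (hv : bigVertex k x ∈ informedSet (EB k) (startWith k (bigCall k x)) v 1) (a : EBVertex k) :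
    a ∈ informedSet (EB k) (startWith k (bigCall k x)) v k := by
  induction a using EBVertex.induction with
  | hnone => exact informedSet_mono _ _ _ (by omega) (none_mem_informedSet_one _ v)
  | hbig w hw =>
    have := informedSet_bigCall_big hk hx hv (k - 1) (by omega) (by omega) w hw
    rwa [show k - 1 + 1 = k by omega] at this
  | hsmall w hw h0 =>
    have := informedSet_bigCall_small (x := x) (v := v) (k / 2) le_rfl w hw h0
    rwa [show k - 1 - k / 2 + k / 2 + 1 = k by omega] at this

end BigOriginator

section SmallOriginator

variable {k y : ℕ} {v : EBVertex k}

theorem informedSet_smallCall_big (c : ℕ) (hc : c < k) (w : ℕ) (hw : w < 2 ^ c) (h0 : w ≠ 0) :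
    bigVertex k w ∈ informedSet (EB k) (startWith k (smallCall k)) v (c + 1) := by
  induction c generalizing w with
  | zero => simp at hw; omega
  | succ c ih =>
    have hpow : 2 ^ (c + 1) = 2 ^ c + 2 ^ c := by rw [pow_succ]; omega
    have hbig : 2 ^ (c + 1) ≤ 2 ^ (k - 1) := Nat.pow_le_pow_right (by norm_num) (by omega)
    by_cases hlow : w < 2 ^ c
    · exact informedSet_mono_succ _ _ _ _ (ih (by omega) w hlow h0)
    · obtain ⟨u, rfl⟩ : ∃ u, w = u + 2 ^ c := ⟨w - 2 ^ c, by omega⟩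
      by_cases hu : u = 0
      · subst hu
        refine mem_informedSet_succ_of_call (none_mem_informedSet _ _) ?_
          (EB_adj_none_bigVertex (by omega))
        simp [startWith, smallCall]
      · refine mem_informedSet_succ_of_call (ih (by omega) u (by omega) hu) ?_
          (EB_adj_bigVertex (by omega) (by omega))
        rw [bigVertex_of_lt (by omega)]
        simp [startWith, smallCall, hu]

theorem smallCall_smallVertex_climb {w c i : ℕ} (hw : w < 2 ^ c) (h : w + 2 ^ c < 2 ^ (k / 2))
    (hi : i ≤ k - 1 - k / 2) :
    startWith k (smallCall k) (i + 1) (smallVertex k (w + 2 ^ c)) = smallVertex k w := by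
  rw [smallVertex_of_lt h (by omega)]
  simp only [startWith, smallCall]
  rw [if_pos (by omega), btParent_add_two_pow hw]

theorem smallCall_smallVertex_spread {w j : ℕ} (h : w < 2 ^ (k / 2)) (hj : j = 0 → w = 0) :
    startWith k (smallCall k) (k - 1 - k / 2 + j + 1) (smallVertex k w) =
      smallVertex k (w + 2 ^ j) := by
  have hexp : k - 1 - k / 2 + j + 1 - (k - 1 - k / 2) - 1 = j := by omega
  by_cases h0 : w = 0
  · subst h0
    rw [smallVertex_zero, bigVertex_of_lt (by positivity)]
    simp only [startWith, smallCall]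
    rw [if_pos trivial, hexp, zero_add]
  · rw [smallVertex_of_lt h h0]
    simp only [startWith, smallCall]
    rw [if_neg (by omega), hexp]

theorem informedSet_smallCall_climb (hk : 2 ≤ k) (hy : y < 2 ^ (k / 2))
    (hv : smallVertex k y ∈ informedSet (EB k) (startWith k (smallCall k)) v 1) (i : ℕ)
    (hi : i + 1 ≤ k / 2) :
    smallVertex k (y % 2 ^ (k / 2 - i)) ∈
      informedSet (EB k) (startWith k (smallCall k)) v (i + 1) := by
  induction i with
  | zero => simpa [Nat.mod_eq_of_lt hy] using hv
  | succ i ih =>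
    have hinf := ih (by omega)
    obtain ⟨c, hc⟩ : ∃ c, k / 2 - i = c + 1 := ⟨k / 2 - i - 1, by omega⟩
    rw [hc] at hinf
    rw [show k / 2 - (i + 1) = c by omega]
    rcases mod_two_pow_succ_cases y c with ⟨h, -⟩ | ⟨h, -⟩ <;> rw [h] at hinf
    · exact informedSet_mono_succ _ _ _ _ hinf
    · have hlt : y % 2 ^ c < 2 ^ c := Nat.mod_lt _ (by positivity)
      have hle : y % 2 ^ c + 2 ^ c < 2 ^ (k / 2) := h ▸ (Nat.mod_le _ _).trans_lt hy
      exact mem_informedSet_succ_of_call hinf (smallCall_smallVertex_climb hlt hle (by omega))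
        (EB_adj_smallVertex hlt hle).symm

theorem informedSet_smallCall_small (hk : 2 ≤ k) (hy : y < 2 ^ (k / 2))
    (hv : smallVertex k y ∈ informedSet (EB k) (startWith k (smallCall k)) v 1) (j : ℕ)
    (hj : 1 ≤ j) (hjk : j ≤ k / 2) (w : ℕ) (hw : w < 2 ^ j) :
    smallVertex k w ∈ informedSet (EB k) (startWith k (smallCall k)) v
      (k - 1 - k / 2 + j + 1) := by
  induction j, hj using Nat.le_induction generalizing w with
  | base =>
    have htwo : 2 ^ 1 ≤ 2 ^ (k / 2) := Nat.pow_le_pow_right (by norm_num) hjk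
    have hclimb : smallVertex k (y % 2) ∈
        informedSet (EB k) (startWith k (smallCall k)) v (k - 1 - k / 2 + 1) := by
      have := informedSet_smallCall_climb hk hy hv (k / 2 - 1) (by omega)
      rw [show k / 2 - (k / 2 - 1) = 1 by omega, pow_one] at this
      exact informedSet_mono _ _ _ (by omega) this
    by_cases hwy : w = y % 2
    · exact hwy ▸ informedSet_mono_succ _ _ _ _ hclimb
    · have hadj : (EB k).Adj (smallVertex k 0) (smallVertex k 1) :=
        EB_adj_smallVertex (c := 0) (by norm_num) (by omega)
      rcases Nat.mod_two_eq_zero_or_one y with h | h <;> rw [h] at hclimb hwy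
      · obtain rfl : w = 1 := by omega
        exact mem_informedSet_succ_of_call hclimb
          (smallCall_smallVertex_spread (j := 0) (by omega) (by simp)) hadj
      · obtain rfl : w = 0 := by omega
        exact mem_informedSet_succ_of_call hclimb
          (smallCall_smallVertex_climb (c := 0) (by norm_num) (by omega) le_rfl) hadj.symm
  | succ j hj ih =>
    have hpow : 2 ^ (j + 1) = 2 ^ j + 2 ^ j := by rw [pow_succ]; omega
    have hsmall : 2 ^ (j + 1) ≤ 2 ^ (k / 2) := Nat.pow_le_pow_right (by norm_num) hjk
    rw [← add_assoc (k - 1 - k / 2) j 1]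
    by_cases hlow : w < 2 ^ j
    · exact informedSet_mono_succ _ _ _ _ (ih (by omega) w hlow)
    · obtain ⟨u, rfl⟩ : ∃ u, w = u + 2 ^ j := ⟨w - 2 ^ j, by omega⟩
      exact mem_informedSet_succ_of_call (ih (by omega) u (by omega))
        (smallCall_smallVertex_spread (by omega) (by omega))
        (EB_adj_smallVertex (by omega) (by omega))

theorem mem_informedSet_smallCall (hk : 2 ≤ k) (hy : y < 2 ^ (k / 2))
    (hv : smallVertex k y ∈ informedSet (EB k) (startWith k (smallCall k)) v 1)
    (a : EBVertex k) : a ∈ informedSet (EB k) (startWith k (smallCall k)) v k := by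
  have hsmall : ∀ w < 2 ^ (k / 2),
      smallVertex k w ∈ informedSet (EB k) (startWith k (smallCall k)) v k := fun w hw => by
    have := informedSet_smallCall_small hk hy hv (k / 2) (by omega) le_rfl w hw
    rwa [show k - 1 - k / 2 + k / 2 + 1 = k by omega] at this
  induction a using EBVertex.induction with
  | hnone => exact informedSet_mono _ _ _ (by omega) (none_mem_informedSet_one _ v)
  | hbig w hw =>
    by_cases h0 : w = 0
    · rw [h0, ← smallVertex_zero]
      exact hsmall 0 (by positivity)
    · have := informedSet_smallCall_big (v := v) (k - 1) (by omega) w hw h0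
      rwa [show k - 1 + 1 = k by omega] at this
  | hsmall w hw h0 => exact hsmall w hw

end SmallOriginator

theorem card_EBVertex (k : ℕ) :
    Fintype.card (EBVertex k) = 2 ^ (k - 1) + 2 ^ (k / 2) := by
  have hpos : 0 < 2 ^ (k / 2) := by positivity
  have hsub : Fintype.card {j : Fin (2 ^ (k / 2)) // (j : ℕ) ≠ 0} = 2 ^ (k / 2) - 1 := by
    have : ∀ j : Fin (2 ^ (k / 2)), (j : ℕ) ≠ 0 ↔ ¬ j = ⟨0, hpos⟩ := fun j => by
      rw [Fin.ext_iff]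
    rw [Fintype.card_congr (Equiv.subtypeEquivRight this), Fintype.card_subtype_compl,
      Fintype.card_subtype_eq, Fintype.card_fin]
  rw [Fintype.card_option, Fintype.card_sum, hsub, Fintype.card_fin]
  omega

theorem clog_card_EBVertex {k : ℕ} (hk : 2 ≤ k) :
    Nat.clog 2 (2 ^ (k - 1) + 2 ^ (k / 2)) = k := by
  have hpow : 2 ^ k = 2 ^ (k - 1) + 2 ^ (k - 1) := by
    rw [← two_mul, ← pow_succ', show k - 1 + 1 = k by omega]
  have hle : 2 ^ (k / 2) ≤ 2 ^ (k - 1) := Nat.pow_le_pow_right (by norm_num) (by omega)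
  have hpos : 0 < 2 ^ (k / 2) := by positivity
  apply le_antisymm
  · rw [Nat.clog_le_iff_le_pow one_lt_two]
    omega
  · have : k - 1 < Nat.clog 2 (2 ^ (k - 1) + 2 ^ (k / 2)) := by
      rw [Nat.lt_clog_iff_pow_lt one_lt_two]
      omega
    omega

theorem broadcastTimeFrom_EB {k : ℕ} (hk : 2 ≤ k) (v : EBVertex k) :
    broadcastTimeFrom (EB k) v = k := by
  have hcard : Nat.clog 2 (Fintype.card (EBVertex k)) = k := by
    rw [card_EBVertex, clog_card_EBVertex hk]
  have hself : ∀ call, v ∈ informedSet (EB k) call v 1 := fun call =>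
    informedSet_mono_succ _ _ _ 0 (Finset.mem_singleton_self v)
  induction v using EBVertex.induction with
  | hnone =>
    exact broadcastTimeFrom_eq (mem_informedSet_bigCall hk (by positivity)
      (bigVertex_zero_mem_informedSet_one _)) hcard
  | hbig x hx => exact broadcastTimeFrom_eq (mem_informedSet_bigCall hk hx (hself _)) hcard
  | hsmall y hy _ => exact broadcastTimeFrom_eq (mem_informedSet_smallCall hk hy (hself _)) hcard

/-- For every `k ≥ 2`, the Extended-Binomial SP graph `EB k` on
`n = 2^(k-1) + 2^⌊k/2⌋` vertices has broadcast time `b(EB k) = ⌈log₂ n⌉ = k`,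
i.e. `EB k` is a broadcast graph. -/
theorem broadcastTime_EB (k : ℕ) (hk : 2 ≤ k) :
    Fintype.card (EBVertex k) = 2 ^ (k - 1) + 2 ^ (k / 2) ∧
    broadcastTime (EB k) = k ∧
    Nat.clog 2 (2 ^ (k - 1) + 2 ^ (k / 2)) = k := by
  refine ⟨card_EBVertex k, ?_, clog_card_EBVertex hk⟩
  rw [broadcastTime, Finset.sup_congr rfl fun v _ => broadcastTimeFrom_EB hk v,
    Finset.sup_const Finset.univ_nonempty]
end
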